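/- arXiv:2601.05771 — 11 statements merged into one kernel-verified Lean document; each statement's English description precedes it below -/
import Mathlib

section
/- Let G be a connected finite simple graph on n ≥ 2 vertices. Then b(G) ≥ n / (2·⌈n/2⌉·⌊n/2⌋); that is, b(G) ≥ b(P_n), where P_n is the path graph on n vertices (whose ℓ1-Fiedler value equals 2/n when n is even and 2n/(n²−1) when n is odd). -/
open Finset

open Classical in
/-- The ℓ1-Fiedler value `b(G)`: the minimum of `∑_{uv ∈ E(G)} |x_u - x_v|` over all
`x : V → ℝ` with `∑_v x_v = 0` and `∑_v |x_v| = 1`.  (Each edge `uv` contributes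
`|x_u - x_v|` once; the double sum over ordered pairs counts it twice, whence the `1/2`.) -/
noncomputable def l1Fiedler {V : Type*} [Fintype V] (G : SimpleGraph V) : ℝ :=
  sInf { y : ℝ | ∃ x : V → ℝ, (∑ v, x v) = 0 ∧ (∑ v, |x v|) = 1 ∧
    y = (1 / 2) * ∑ u, ∑ v, if G.Adj u v then |x u - x v| else 0 }

/-- Along a path, the drop of `x` is at most the total drop of `x` across the ordered pairs of
adjacent vertices whose first entry lies on the path. -/
lemma SimpleGraph.Walk.IsPath.sub_le_sum_posPart {V : Type*} [Fintype V] [DecidableEq V]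
    {G : SimpleGraph V} [DecidableRel G.Adj] (x : V → ℝ) {u v : V} {p : G.Walk u v}
    (hp : p.IsPath) :
    x u - x v ≤ ∑ a ∈ p.support.toFinset, ∑ b, if G.Adj a b then max (x a - x b) 0 else 0 := by
  have hnonneg (a b : V) : 0 ≤ if G.Adj a b then max (x a - x b) 0 else 0 := by
    split_ifs
    exacts [le_max_right _ _, le_rfl]
  induction p with
  | nil =>
    rw [sub_self]
    exact Finset.sum_nonneg fun a _ => Finset.sum_nonneg fun b _ => hnonneg a b
  | @cons u w v h p ih =>
    rw [SimpleGraph.Walk.cons_isPath_iff] at hp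
    rw [SimpleGraph.Walk.support_cons, List.toFinset_cons,
      Finset.sum_insert (by simpa using hp.2)]
    have hstep := Finset.single_le_sum (fun b _ => hnonneg u b) (Finset.mem_univ w)
    rw [if_pos h] at hstep
    linarith [ih hp.1, le_max_left (x u - x w) 0]

/-- In a connected graph the total variation of `x` over the edges dominates every difference
of values of `x`. -/
lemma SimpleGraph.Connected.sub_le_half_sum {V : Type*} [Fintype V] {G : SimpleGraph V}
    [DecidableRel G.Adj] (hG : G.Connected) (x : V → ℝ) (u v : V) :
    x u - x v ≤ (1 / 2) * ∑ a, ∑ b, if G.Adj a b then |x a - x b| else 0 := by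
  classical
  obtain ⟨p, hp⟩ := hG.exists_isPath u v
  have hpath := hp.sub_le_sum_posPart x
  have hsub : ∑ a ∈ p.support.toFinset, ∑ b, (if G.Adj a b then max (x a - x b) 0 else 0) ≤
      ∑ a, ∑ b, if G.Adj a b then max (x a - x b) 0 else 0 := by
    refine Finset.sum_le_sum_of_subset_of_nonneg (Finset.subset_univ _) fun a _ _ =>
      Finset.sum_nonneg fun b _ => ?_
    split_ifs
    exacts [le_max_right _ _, le_rfl]
  have hswap : ∑ a, ∑ b, (if G.Adj a b then max (x a - x b) 0 else 0) =
      ∑ a, ∑ b, if G.Adj a b then max (x b - x a) 0 else 0 := by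
    rw [Finset.sum_comm]
    simp only [G.adj_comm]
  have habs : ∑ a, ∑ b, (if G.Adj a b then |x a - x b| else 0) =
      ∑ a, ∑ b, (if G.Adj a b then max (x a - x b) 0 else 0) +
        ∑ a, ∑ b, if G.Adj a b then max (x b - x a) 0 else 0 := by
    simp only [← Finset.sum_add_distrib]
    refine Finset.sum_congr rfl fun a _ => Finset.sum_congr rfl fun b _ => ?_
    split_ifs
    · rcases le_total (x a) (x b) with h | h
      · rw [abs_of_nonpos (by linarith), max_eq_right (by linarith), max_eq_left (by linarith)]
        ring
      · rw [abs_of_nonneg (by linarith), max_eq_left (by linarith), max_eq_right (by linarith)]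
        ring
    · simp
  linarith

/-- A vector with zero sum and unit `ℓ1` norm has two entries that differ by at least
`n / (2 ⌈n/2⌉ ⌊n/2⌋)`. -/
lemma exists_div_le_sub_of_sum_eq_zero {V : Type*} [Fintype V] (x : V → ℝ)
    (hsum : ∑ v, x v = 0) (habs : ∑ v, |x v| = 1) :
    ∃ u v, (Fintype.card V : ℝ) /
      (2 * (((Fintype.card V + 1) / 2 : ℕ) : ℝ) * ((Fintype.card V / 2 : ℕ) : ℝ)) ≤
        x u - x v := by
  classical
  set P := Finset.univ.filter fun v => 0 < x v
  set N := Finset.univ.filter fun v => ¬ 0 < x v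
  have hcard : P.card + N.card = Fintype.card V :=
    Finset.card_filter_add_card_filter_not _
  have hs : ∑ v ∈ P, x v + ∑ v ∈ N, x v = 0 := by
    rw [← hsum]; exact Finset.sum_filter_add_sum_filter_not _ _ _
  have ha : ∑ v ∈ P, x v - ∑ v ∈ N, x v = 1 := by
    rw [← habs, ← Finset.sum_filter_add_sum_filter_not Finset.univ (fun v => 0 < x v),
      sub_eq_add_neg, ← Finset.sum_neg_distrib]
    congr 1
    · exact Finset.sum_congr rfl fun v hv => (abs_of_pos (Finset.mem_filter.mp hv).2).symm
    · exact Finset.sum_congr rfl fun v hv =>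
        (abs_of_nonpos (not_lt.mp (Finset.mem_filter.mp hv).2)).symm
  have hPs : ∑ v ∈ P, x v = 1 / 2 := by linarith
  have hNs : ∑ v ∈ N, x v = -(1 / 2) := by linarith
  have hP : P.Nonempty := Finset.nonempty_of_sum_ne_zero (f := x) (by rw [hPs]; norm_num)
  have hN : N.Nonempty := Finset.nonempty_of_sum_ne_zero (f := x) (by rw [hNs]; norm_num)
  obtain ⟨u, -, hu⟩ := P.exists_max_image x hP
  obtain ⟨v, -, hv⟩ := N.exists_min_image x hN
  refine ⟨u, v, ?_⟩
  have hu' := Finset.sum_le_card_nsmul P x (x u) hu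
  have hv' := Finset.card_nsmul_le_sum N x (x v) hv
  rw [nsmul_eq_mul] at hu' hv'
  rw [hPs] at hu'
  rw [hNs] at hv'
  have hPc := hP.card_pos
  have hNc := hN.card_pos
  have hprod : P.card * N.card ≤ (Fintype.card V + 1) / 2 * (Fintype.card V / 2) := by
    rw [← hcard]
    generalize P.card = p at *
    generalize N.card = q at *
    obtain ⟨k, hk | hk⟩ : ∃ k, p + q = 2 * k ∨ p + q = 2 * k + 1 := ⟨(p + q) / 2, by omega⟩
    · rw [hk, show (2 * k + 1) / 2 = k by omega, show 2 * k / 2 = k by omega]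
      zify at *
      nlinarith [sq_nonneg ((p : ℤ) - q)]
    · rw [hk, show (2 * k + 1 + 1) / 2 = k + 1 by omega, show (2 * k + 1) / 2 = k by omega]
      rcases le_or_gt p k with h | h
      · obtain ⟨d, rfl⟩ := Nat.exists_eq_add_of_le h
        obtain rfl : q = p + 2 * d + 1 := by omega
        nlinarith [Nat.zero_le d]
      · obtain ⟨d, rfl⟩ : ∃ d, p = k + 1 + d := ⟨p - (k + 1), by omega⟩
        obtain rfl : k = q + d := by omega
        nlinarith [Nat.zero_le d]
  have hp : (0 : ℝ) < P.card := by exact_mod_cast hPc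
  have hq : (0 : ℝ) < N.card := by exact_mod_cast hNc
  have hc : (Fintype.card V : ℝ) = P.card + N.card := by exact_mod_cast hcard.symm
  have hu'' : 1 / (2 * (P.card : ℝ)) ≤ x u := by
    rw [div_le_iff₀ (by positivity)]; linarith
  have hv'' : 1 / (2 * (N.card : ℝ)) ≤ -x v := by
    rw [div_le_iff₀ (by positivity)]; linarith
  calc _ ≤ (Fintype.card V : ℝ) / (2 * P.card * N.card) := by
        refine div_le_div_of_nonneg_left (by positivity) (by positivity) ?_
        rw [mul_assoc, mul_assoc]
        exact mul_le_mul_of_nonneg_left (by exact_mod_cast hprod) zero_le_two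
    _ = 1 / (2 * (P.card : ℝ)) + 1 / (2 * (N.card : ℝ)) := by
        rw [hc]; field_simp; ring
    _ ≤ x u - x v := by linarith

/-- The vector on `Fin n` that is a negative constant on the first `⌈n/2⌉` entries, a positive
constant on the others, and has zero sum and unit `ℓ1` norm. -/
noncomputable def halfStep (n : ℕ) (i : Fin n) : ℝ :=
  if (i : ℕ) < (n + 1) / 2 then -(1 / (2 * (((n + 1) / 2 : ℕ) : ℝ)))
  else 1 / (2 * ((n / 2 : ℕ) : ℝ))

lemma sum_ite_val_lt (n : ℕ) (c d : ℝ) :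
    ∑ i : Fin n, (if (i : ℕ) < (n + 1) / 2 then c else d) =
      ((n + 1) / 2 : ℕ) * c + (n / 2 : ℕ) * d := by
  rw [Fin.sum_univ_eq_sum_range (fun i => if i < (n + 1) / 2 then c else d) n]
  conv_lhs => rw [show n = (n + 1) / 2 + n / 2 by omega]
  rw [Finset.sum_range_add]
  have h : (n + 1) / 2 + n / 2 = n := by omega
  rw [h]
  congr 1
  · rw [Finset.sum_congr rfl fun i hi => if_pos (Finset.mem_range.mp hi)]
    simp
  · simp

lemma sum_halfStep {n : ℕ} (hn : 2 ≤ n) : ∑ i, halfStep n i = 0 := by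
  have ha : (((n + 1) / 2 : ℕ) : ℝ) ≠ 0 := by norm_cast; omega
  have hb : ((n / 2 : ℕ) : ℝ) ≠ 0 := by norm_cast; omega
  simp only [halfStep]
  rw [sum_ite_val_lt]
  field_simp
  ring

lemma sum_abs_halfStep {n : ℕ} (hn : 2 ≤ n) : ∑ i, |halfStep n i| = 1 := by
  have ha : (((n + 1) / 2 : ℕ) : ℝ) ≠ 0 := by norm_cast; omega
  have hb : ((n / 2 : ℕ) : ℝ) ≠ 0 := by norm_cast; omega
  simp only [halfStep, apply_ite abs, abs_neg]
  rw [sum_ite_val_lt, abs_of_nonneg (by positivity), abs_of_nonneg (by positivity)]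
  field_simp
  norm_num

lemma half_sum_pathGraph_halfStep {n : ℕ} (hn : 2 ≤ n)
    [DecidableRel (SimpleGraph.pathGraph n).Adj] :
    (1 / 2) * ∑ i, ∑ j,
        (if (SimpleGraph.pathGraph n).Adj i j then |halfStep n i - halfStep n j| else 0) =
      (n : ℝ) / (2 * (((n + 1) / 2 : ℕ) : ℝ) * ((n / 2 : ℕ) : ℝ)) := by
  set c : ℝ := (n : ℝ) / (2 * (((n + 1) / 2 : ℕ) : ℝ) * ((n / 2 : ℕ) : ℝ)) with hc
  have ha : (((n + 1) / 2 : ℕ) : ℝ) ≠ 0 := by norm_cast; omega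
  have hb : ((n / 2 : ℕ) : ℝ) ≠ 0 := by norm_cast; omega
  have hgap : 1 / (2 * ((n / 2 : ℕ) : ℝ)) + 1 / (2 * (((n + 1) / 2 : ℕ) : ℝ)) = c := by
    have h : (n : ℝ) = ((n + 1) / 2 : ℕ) + (n / 2 : ℕ) := by norm_cast; omega
    rw [hc]
    rw [h]
    field_simp
  have hc0 : 0 ≤ c := by positivity
  let s : Fin n := ⟨(n + 1) / 2 - 1, by omega⟩
  let t : Fin n := ⟨(n + 1) / 2, by omega⟩
  have hterm (i j : Fin n) :
      (if (SimpleGraph.pathGraph n).Adj i j then |halfStep n i - halfStep n j| else 0) =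
        (if i = s then if j = t then c else 0 else 0) +
          if i = t then if j = s then c else 0 else 0 := by
    simp only [SimpleGraph.pathGraph_adj, halfStep, Fin.ext_iff, s, t]
    split_ifs <;> first
      | omega
      | (rw [sub_self, abs_zero, add_zero])
      | (rw [abs_sub_comm, sub_neg_eq_add, hgap, abs_of_nonneg hc0]; ring)
      | (rw [sub_neg_eq_add, hgap, abs_of_nonneg hc0]; ring)
      | ring
  simp only [hterm, Finset.sum_add_distrib, Finset.sum_ite_eq', Finset.mem_univ, if_true,
    Finset.sum_ite_irrel, Finset.sum_const_zero]
  ring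

lemma l1Fiedler_pathGraph_le {n : ℕ} (hn : 2 ≤ n) :
    l1Fiedler (SimpleGraph.pathGraph n) ≤
      (n : ℝ) / (2 * (((n + 1) / 2 : ℕ) : ℝ) * ((n / 2 : ℕ) : ℝ)) := by
  classical
  refine csInf_le ⟨0, ?_⟩ ⟨halfStep n, sum_halfStep hn, sum_abs_halfStep hn,
    (half_sum_pathGraph_halfStep hn).symm⟩
  rintro _ ⟨x, -, -, rfl⟩
  refine mul_nonneg (by norm_num) (Finset.sum_nonneg fun u _ => Finset.sum_nonneg fun v _ => ?_)
  split_ifs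
  exacts [abs_nonneg _, le_rfl]

lemma SimpleGraph.Connected.le_l1Fiedler {V : Type*} [Fintype V] {G : SimpleGraph V}
    (hG : G.Connected) (hn : 2 ≤ Fintype.card V) :
    (Fintype.card V : ℝ) /
      (2 * (((Fintype.card V + 1) / 2 : ℕ) : ℝ) * ((Fintype.card V / 2 : ℕ) : ℝ)) ≤
        l1Fiedler G := by
  classical
  let e := Fintype.equivFin V
  refine le_csInf ⟨_, fun v => halfStep _ (e v), ?_, ?_, rfl⟩ ?_
  · rw [e.sum_comp (halfStep _), sum_halfStep hn]
  · rw [e.sum_comp fun i => |halfStep _ i|, sum_abs_halfStep hn]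
  · rintro _ ⟨x, hsum, habs, rfl⟩
    obtain ⟨u, v, h⟩ := exists_div_le_sub_of_sum_eq_zero x hsum habs
    exact h.trans (hG.sub_le_half_sum x u v)

/-- For a connected graph `G` on `n ≥ 2` vertices,
`b(G) ≥ n / (2 ⌈n/2⌉ ⌊n/2⌋)`, i.e. `b(G) ≥ b(P_n)`. -/
theorem stmt1 {V : Type*} [Fintype V] (G : SimpleGraph V) (hG : G.Connected)
    (hn : 2 ≤ Fintype.card V) :
    l1Fiedler G ≥ (Fintype.card V : ℝ) /
      (2 * (((Fintype.card V + 1) / 2 : ℕ) : ℝ) * ((Fintype.card V / 2 : ℕ) : ℝ)) ∧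
    l1Fiedler G ≥ l1Fiedler (SimpleGraph.pathGraph (Fintype.card V)) := by
  exact ⟨hG.le_l1Fiedler hn, (l1Fiedler_pathGraph_le hn).trans (hG.le_l1Fiedler hn)⟩
end

section
/- Let G be a connected finite simple graph on n ≥ 2 vertices and let G^c be its complement. Then b(G) + b(G^c) ≤ n/2, and equality holds if and only if G is isomorphic to the complete graph K_n. -/
open Finset

open Classical in
/-- The `ℓ1` variation `∑_{uv ∈ E(G)} |x_u - x_v|` of a function on the vertices of `G`. -/
noncomputable def l1Variation {V : Type*} [Fintype V] (G : SimpleGraph V) (x : V → ℝ) : ℝ :=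
  (1 / 2) * ∑ u, ∑ v, if G.Adj u v then |x u - x v| else 0

lemma l1Variation_nonneg {V : Type*} [Fintype V] (G : SimpleGraph V) (x : V → ℝ) :
    0 ≤ l1Variation G x := by
  unfold l1Variation
  refine mul_nonneg (by norm_num) (Finset.sum_nonneg fun u _ ↦ Finset.sum_nonneg fun v _ ↦ ?_)
  split_ifs <;> positivity

lemma l1Fiedler_le {V : Type*} [Fintype V] (G : SimpleGraph V) (x : V → ℝ)
    (h0 : ∑ v, x v = 0) (h1 : ∑ v, |x v| = 1) : l1Fiedler G ≤ l1Variation G x := by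
  refine csInf_le ⟨0, ?_⟩ ⟨x, h0, h1, rfl⟩
  rintro y ⟨z, -, -, rfl⟩
  exact l1Variation_nonneg G z

lemma l1Variation_add_compl {V : Type*} [Fintype V] (G : SimpleGraph V) (x : V → ℝ) :
    l1Variation G x + l1Variation Gᶜ x = (1 / 2) * ∑ u, ∑ v, |x u - x v| := by
  unfold l1Variation
  rw [← mul_add, ← Finset.sum_add_distrib]
  simp_rw [← Finset.sum_add_distrib]
  congr 1
  refine Finset.sum_congr rfl fun u _ ↦ Finset.sum_congr rfl fun v _ ↦ ?_
  by_cases huv : u = v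
  · simp [huv]
  · by_cases h : G.Adj u v <;> simp [SimpleGraph.compl_adj, h, huv]

/-- The indicator function of `S`, with real values. -/
noncomputable def realIndicator {V : Type*} (S : Finset V) : V → ℝ :=
  (S : Set V).indicator 1

lemma realIndicator_apply {V : Type*} [DecidableEq V] (S : Finset V) (v : V) :
    realIndicator S v = if v ∈ S then 1 else 0 := by
  simp [realIndicator, Set.indicator_apply]

lemma sum_realIndicator {V : Type*} [Fintype V] (S : Finset V) :
    ∑ v, realIndicator S v = #S := by
  classical
  simp [realIndicator_apply]

lemma l1Variation_realIndicator_add_compl {V : Type*} [Fintype V] (G : SimpleGraph V)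
    (S : Finset V) :
    l1Variation G (realIndicator S) + l1Variation Gᶜ (realIndicator S) =
      #S * (Fintype.card V - #S) := by
  classical
  have key (u v : V) : |realIndicator S u - realIndicator S v| =
      realIndicator S u + realIndicator S v - 2 * (realIndicator S u * realIndicator S v) := by
    simp only [realIndicator_apply]
    split_ifs <;> norm_num
  rw [l1Variation_add_compl]
  simp only [key, Finset.sum_sub_distrib, Finset.sum_add_distrib, ← Finset.mul_sum,
    ← Finset.sum_mul, sum_realIndicator, Finset.sum_const, Finset.card_univ, nsmul_eq_mul]
  ring

lemma l1Variation_mul_sub_const {V : Type*} [Fintype V] (G : SimpleGraph V) (x : V → ℝ)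
    {r : ℝ} (hr : 0 ≤ r) (t : ℝ) :
    l1Variation G (fun v ↦ r * x v - t) = r * l1Variation G x := by
  unfold l1Variation
  rw [mul_left_comm, Finset.mul_sum]
  simp_rw [Finset.mul_sum]
  refine Finset.sum_congr rfl fun u _ ↦ Finset.sum_congr rfl fun v _ ↦ congrArg _ ?_
  split_ifs
  · rw [show r * x u - t - (r * x v - t) = r * (x u - x v) by ring, abs_mul, abs_of_nonneg hr]
  · simp

/-- Every cut bounds the `ℓ1`-Fiedler value from above. -/
lemma l1Fiedler_mul_le_cut {V : Type*} [Fintype V] (G : SimpleGraph V) (S : Finset V) :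
    l1Fiedler G * (#S * (Fintype.card V - #S)) ≤
      Fintype.card V / 2 * l1Variation G (realIndicator S) := by
  classical
  have hle : (#S : ℝ) ≤ Fintype.card V := by exact_mod_cast S.card_le_univ
  have hnn : 0 ≤ (Fintype.card V : ℝ) / 2 * l1Variation G (realIndicator S) :=
    mul_nonneg (by positivity) (l1Variation_nonneg _ _)
  rcases (Nat.cast_nonneg (α := ℝ) #S).eq_or_lt with h | hs
  · simpa [← h] using hnn
  rcases hle.eq_or_lt with h | hlt
  · simpa [h] using hnn
  set s : ℝ := (#S : ℝ)
  set n : ℝ := (Fintype.card V : ℝ)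
  have hns : 0 < n - s := sub_pos.2 hlt
  have hr : 0 ≤ n / (2 * s * (n - s)) := by positivity
  have hval (v : V) : |n / (2 * s * (n - s)) * realIndicator S v - 1 / (2 * (n - s))| =
      (1 / (2 * s) - 1 / (2 * (n - s))) * realIndicator S v + 1 / (2 * (n - s)) := by
    rw [realIndicator_apply]
    split_ifs
    · rw [show n / (2 * s * (n - s)) * 1 - 1 / (2 * (n - s)) = 1 / (2 * s) by field_simp,
        abs_of_pos (by positivity)]
      ring
    · rw [mul_zero, zero_sub, abs_neg, abs_of_pos (by positivity)]
      ring
  have h := l1Fiedler_le G (fun v ↦ n / (2 * s * (n - s)) * realIndicator S v - 1 / (2 * (n - s)))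
    (by
      rw [Finset.sum_sub_distrib, ← Finset.mul_sum, sum_realIndicator, Finset.sum_const,
        Finset.card_univ, nsmul_eq_mul]
      change n / (2 * s * (n - s)) * s - n * (1 / (2 * (n - s))) = 0
      field_simp
      ring)
    (by
      simp_rw [hval]
      rw [Finset.sum_add_distrib, ← Finset.mul_sum, sum_realIndicator, Finset.sum_const,
        Finset.card_univ, nsmul_eq_mul]
      change (1 / (2 * s) - 1 / (2 * (n - s))) * s + n * (1 / (2 * (n - s))) = 1
      field_simp
      ring)
  rw [l1Variation_mul_sub_const G _ hr] at h
  calc l1Fiedler G * (s * (n - s))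
      ≤ n / (2 * s * (n - s)) * l1Variation G (realIndicator S) * (s * (n - s)) := by gcongr
    _ = n / 2 * l1Variation G (realIndicator S) := by field_simp

open Classical in
lemma l1Variation_realIndicator_pair {V : Type*} [Fintype V] (G : SimpleGraph V) {u v : V}
    (huv : u ≠ v) :
    l1Variation G (realIndicator {u, v}) = l1Variation G (realIndicator {u}) +
      l1Variation G (realIndicator {v}) - 2 * if G.Adj u v then 1 else 0 := by
  have key (a b : V) :
      (if G.Adj a b then |realIndicator {u, v} a - realIndicator {u, v} b| else 0) =
      (if G.Adj a b then |realIndicator {u} a - realIndicator {u} b| else 0) +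
      (if G.Adj a b then |realIndicator {v} a - realIndicator {v} b| else 0) -
      ((if a = u then if b = v then (if G.Adj u v then (2 : ℝ) else 0) else 0 else 0) +
       (if a = v then if b = u then (if G.Adj u v then (2 : ℝ) else 0) else 0 else 0)) := by
    simp only [realIndicator_apply, Finset.mem_insert, Finset.mem_singleton]
    by_cases h1 : a = u <;> by_cases h2 : a = v <;> by_cases h3 : b = u <;>
      by_cases h4 : b = v <;> by_cases h5 : G.Adj a b <;>
      simp_all [G.adj_comm] <;> norm_num
  unfold l1Variation
  simp_rw [key, Finset.sum_sub_distrib, Finset.sum_add_distrib]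
  simp only [Finset.sum_ite_eq', Finset.sum_ite_irrel, Finset.sum_const_zero, Finset.mem_univ,
    if_true]
  split_ifs <;> ring

lemma exists_l1Fiedler_competitor {V : Type*} [Fintype V] (hn : 2 ≤ Fintype.card V) :
    ∃ x : V → ℝ, ∑ v, x v = 0 ∧ ∑ v, |x v| = 1 := by
  classical
  obtain ⟨u, v, huv⟩ := Fintype.one_lt_card_iff.1 hn
  refine ⟨fun w ↦ (if w = u then 1 / 2 else 0) - if w = v then 1 / 2 else 0, by simp, ?_⟩
  have (w : V) : |(if w = u then (1 / 2 : ℝ) else 0) - if w = v then 1 / 2 else 0| =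
      (if w = u then 1 / 2 else 0) + if w = v then 1 / 2 else 0 := by
    by_cases h1 : w = u <;> by_cases h2 : w = v <;> simp_all
  simp_rw [this, Finset.sum_add_distrib]
  norm_num

lemma card_div_two_le_l1Fiedler_top {V : Type*} [Fintype V] (hn : 2 ≤ Fintype.card V) :
    (Fintype.card V : ℝ) / 2 ≤ l1Fiedler (⊤ : SimpleGraph V) := by
  obtain ⟨x, h0, h1⟩ := exists_l1Fiedler_competitor hn
  refine le_csInf ⟨_, x, h0, h1, rfl⟩ ?_
  rintro y ⟨z, h0, h1, rfl⟩
  have h (u : V) : Fintype.card V * |z u| ≤ ∑ v, |z u - z v| := by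
    have := Finset.abs_sum_le_sum_abs (fun v ↦ z u - z v) Finset.univ
    rwa [Finset.sum_sub_distrib, h0, Finset.sum_const, Finset.card_univ, nsmul_eq_mul, sub_zero,
      abs_mul, Nat.abs_cast] at this
  have h2 := Finset.sum_le_sum fun u (_ : u ∈ Finset.univ) ↦ h u
  rw [← Finset.mul_sum, h1] at h2
  have h3 := l1Variation_add_compl (⊤ : SimpleGraph V) z
  have h4 : l1Variation (⊤ : SimpleGraph V)ᶜ z = 0 := by simp [l1Variation]
  change _ ≤ l1Variation ⊤ z
  linarith

lemma l1Fiedler_nonneg {V : Type*} [Fintype V] (G : SimpleGraph V) : 0 ≤ l1Fiedler G := by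
  refine Real.sInf_nonneg ?_
  rintro y ⟨z, -, -, rfl⟩
  exact l1Variation_nonneg G z

/-- If equality holds, every cut of `G` has the same density, so `G` is empty or complete. -/
lemma eq_top_of_l1Fiedler_add_compl_eq {V : Type*} [Fintype V] (G : SimpleGraph V)
    (hG : G.Connected) (hn : 2 ≤ Fintype.card V)
    (h : l1Fiedler G + l1Fiedler Gᶜ = (Fintype.card V : ℝ) / 2) : G = ⊤ := by
  classical
  have cut (S : Finset V) : Fintype.card V / 2 * l1Variation G (realIndicator S) =
      l1Fiedler G * (#S * (Fintype.card V - #S)) := by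
    refine le_antisymm ?_ (l1Fiedler_mul_le_cut G S)
    have h1 := l1Fiedler_mul_le_cut Gᶜ S
    have h2 := l1Variation_realIndicator_add_compl G S
    rw [← eq_sub_iff_add_eq'] at h h2
    rw [h, h2] at h1
    linarith
  have dens {u v : V} (huv : u ≠ v) :
      (Fintype.card V : ℝ) / 2 * (if G.Adj u v then 1 else 0) = l1Fiedler G := by
    have h1 := cut {u}
    have h2 := cut {v}
    have h3 := cut {u, v}
    rw [l1Variation_realIndicator_pair G huv, Finset.card_pair huv] at h3
    simp only [Finset.card_singleton, Nat.cast_one, Nat.cast_ofNat] at h1 h2 h3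
    linarith
  have : Nontrivial V := Fintype.one_lt_card_iff_nontrivial.1 hn
  obtain ⟨a⟩ := hG.nonempty
  obtain ⟨b, hab⟩ := hG.preconnected.exists_adj_of_nontrivial a
  have hd := dens hab.ne
  rw [if_pos hab] at hd
  ext u v
  refine ⟨fun h ↦ h.ne, fun huv ↦ ?_⟩
  by_contra hadj
  have := dens (show u ≠ v from huv)
  rw [if_neg hadj, ← hd] at this
  have : (2 : ℝ) ≤ Fintype.card V := by exact_mod_cast hn
  linarith

/-- For a connected graph `G` on `n ≥ 2` vertices,
`b(G) + b(Gᶜ) ≤ n / 2`, with equality iff `G ≅ K_n`. -/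
theorem stmt2 {V : Type*} [Fintype V] (G : SimpleGraph V) (hG : G.Connected)
    (hn : 2 ≤ Fintype.card V) :
    l1Fiedler G + l1Fiedler Gᶜ ≤ (Fintype.card V : ℝ) / 2 ∧
    (l1Fiedler G + l1Fiedler Gᶜ = (Fintype.card V : ℝ) / 2 ↔
      Nonempty (G ≃g (⊤ : SimpleGraph V))) := by
  have hle : l1Fiedler G + l1Fiedler Gᶜ ≤ (Fintype.card V : ℝ) / 2 := by
    obtain ⟨a⟩ := hG.nonempty
    have h1 := l1Fiedler_mul_le_cut G {a}
    have h2 := l1Fiedler_mul_le_cut Gᶜ {a}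
    have h3 := l1Variation_realIndicator_add_compl G {a}
    have hn' : (2 : ℝ) ≤ Fintype.card V := by exact_mod_cast hn
    simp only [Finset.card_singleton, Nat.cast_one, one_mul] at h1 h2 h3
    refine le_of_mul_le_mul_right ?_ (show (0 : ℝ) < Fintype.card V - 1 by linarith)
    rw [← h3] at h1 h2 ⊢
    linarith
  refine ⟨hle, fun h ↦ ?_, fun ⟨e⟩ ↦ le_antisymm hle ?_⟩
  · rw [eq_top_of_l1Fiedler_add_compl_eq G hG hn h]
    exact ⟨SimpleGraph.Iso.refl⟩
  · have hG' : G = ⊤ := by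
      ext u v
      rw [← e.map_adj_iff]
      simp
    subst hG'
    linarith [card_div_two_le_l1Fiedler_top hn, l1Fiedler_nonneg (⊤ : SimpleGraph V)ᶜ]
end

section
/- Let G be a connected finite simple graph on n ≥ 2 vertices and let G^c be its complement. Then b(G) + b(G^c) > 1/2. -/
open Finset

open Classical in
/-- The indicator that the pair `u`, `v` is separated by the cut `(S, Sᶜ)`. -/
noncomputable def cutIndicator {V : Type*} (S : Finset V) (u v : V) : ℝ :=
  if (u ∈ S ↔ v ∈ S) then 0 else 1

lemma cutIndicator_nonneg {V : Type*} (S : Finset V) (u v : V) : 0 ≤ cutIndicator S u v := by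
  unfold cutIndicator; split_ifs <;> norm_num

lemma cutIndicator_le_one {V : Type*} (S : Finset V) (u v : V) : cutIndicator S u v ≤ 1 := by
  unfold cutIndicator; split_ifs <;> norm_num

lemma cutIndicator_self {V : Type*} (S : Finset V) (u : V) : cutIndicator S u u = 0 := by
  simp [cutIndicator]

open MeasureTheory in
/-- Coarea principle: a weighted sum of `|x u - x v|` is nonnegative as soon as the corresponding
weighted sums over all cuts are. -/
lemma sum_mul_abs_sub_nonneg_of_cuts {V : Type*} [Fintype V] (w : V → V → ℝ)
    (hw : ∀ S : Finset V, 0 ≤ ∑ u, ∑ v, w u v * cutIndicator S u v) (x : V → ℝ) :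
    0 ≤ ∑ u, ∑ v, w u v * |x u - x v| := by
  classical
  have hint : ∀ u v, Integrable ((Set.uIoc (x u) (x v)).indicator fun _ => (1 : ℝ)) := fun u v =>
    (integrable_indicator_iff measurableSet_uIoc).2 (integrableOn_const (by simp [Set.uIoc]))
  have habs : ∀ u v, |x u - x v| = ∫ t, (Set.uIoc (x u) (x v)).indicator (fun _ => (1 : ℝ)) t := by
    intro u v
    rw [integral_indicator measurableSet_uIoc, setIntegral_const]
    simp [Set.uIoc, Measure.real, max_sub_min_eq_abs, abs_sub_comm]
  have hkey : ∑ u, ∑ v, w u v * |x u - x v| =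
      ∫ t, ∑ u, ∑ v, w u v * (Set.uIoc (x u) (x v)).indicator (fun _ => (1 : ℝ)) t := by
    rw [integral_finsetSum _ fun u _ => integrable_finsetSum _ fun v _ => (hint u v).const_mul _]
    refine Finset.sum_congr rfl fun u _ => ?_
    rw [integral_finsetSum _ fun v _ => (hint u v).const_mul _]
    refine Finset.sum_congr rfl fun v _ => ?_
    rw [integral_const_mul, habs]
  rw [hkey]
  refine integral_nonneg fun t => ?_
  refine (hw (univ.filter fun u => t ≤ x u)).trans_eq ?_
  refine Finset.sum_congr rfl fun u _ => Finset.sum_congr rfl fun v _ => ?_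
  congr 1
  simp only [cutIndicator, Set.indicator, Set.mem_uIoc, mem_filter, mem_univ, true_and]
  grind

lemma card_mul_sum_abs_le {V : Type*} [Fintype V] (x : V → ℝ) (hx : ∑ v, x v = 0) :
    (Fintype.card V : ℝ) * ∑ u, |x u| ≤ ∑ u, ∑ v, |x u - x v| := by
  rw [Finset.mul_sum]
  refine Finset.sum_le_sum fun u _ => ?_
  calc (Fintype.card V : ℝ) * |x u| = |∑ v, (x u - x v)| := by
        simp [Finset.sum_sub_distrib, hx, abs_mul]
    _ ≤ _ := Finset.abs_sum_le_sum_abs _ _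

open Classical in
/-- Twice the number of edges of `G` crossing the cut `(S, Sᶜ)`. -/
noncomputable def cutWeight {V : Type*} [Fintype V] (G : SimpleGraph V) (S : Finset V) : ℝ :=
  ∑ u, ∑ v, if G.Adj u v then cutIndicator S u v else 0

lemma cutWeight_nonneg {V : Type*} [Fintype V] (G : SimpleGraph V) (S : Finset V) :
    0 ≤ cutWeight G S := by
  classical
  refine Finset.sum_nonneg fun u _ => Finset.sum_nonneg fun v _ => ?_
  split_ifs
  exacts [cutIndicator_nonneg S u v, le_rfl]

/-- A uniform lower bound on the density of all cuts bounds the `ℓ1`-Fiedler value. -/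
lemma le_l1Fiedler_of_cuts {V : Type*} [Fintype V] [Nontrivial V] (G : SimpleGraph V) {κ : ℝ}
    (hκ : 0 ≤ κ) (h : ∀ S : Finset V, κ * ∑ u, ∑ v, cutIndicator S u v ≤ cutWeight G S) :
    κ * Fintype.card V / 2 ≤ l1Fiedler G := by
  classical
  refine le_csInf ?_ ?_
  · obtain ⟨p, q, hpq⟩ := exists_pair_ne V
    refine ⟨_, fun v => if v = p then 1 / 2 else if v = q then -1 / 2 else 0, ?_, ?_, rfl⟩
    · rw [Finset.sum_eq_add p q hpq (by grind) (by simp) (by simp)]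
      simp [hpq.symm]; norm_num
    · rw [Finset.sum_eq_add p q hpq (by grind) (by simp) (by simp)]
      simp [hpq.symm, abs_div]; norm_num
  · rintro y ⟨x, hx0, hx1, rfl⟩
    have hcoarea := sum_mul_abs_sub_nonneg_of_cuts
      (fun u v => (if G.Adj u v then 1 else 0) - κ) (fun S => by
        have := h S
        simp only [cutWeight] at this
        simp only [sub_mul, Finset.sum_sub_distrib, ite_mul, one_mul, zero_mul, ← Finset.mul_sum]
        linarith) x
    simp only [sub_mul, Finset.sum_sub_distrib, ite_mul, one_mul, zero_mul,
      ← Finset.mul_sum] at hcoarea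
    have hcard := mul_le_mul_of_nonneg_left (card_mul_sum_abs_le x hx0) hκ
    rw [hx1, mul_one] at hcard
    linarith

lemma add_mul_add_lt_of_pos {a b c d : ℕ} (hab : 0 < a + b) (hcd : 0 < c + d) (hac : 0 < a + c)
    (hbd : 0 < b + d) : (a + b) * (c + d) < (a + b + c + d) * (a * d + b * c) := by
  rcases Nat.eq_zero_or_pos a with rfl | ha
  · have hb : 0 < b := by omega
    have hc : 0 < c := by omega
    nlinarith [Nat.mul_le_mul hb hc, mul_pos hb hc, Nat.mul_le_mul_left (b * d) hc]
  rcases Nat.eq_zero_or_pos d with rfl | hd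
  · have hb : 0 < b := by omega
    have hc : 0 < c := by omega
    nlinarith [mul_pos hb hc, Nat.mul_le_mul_left (a * c) hb, mul_pos ha hc]
  have had := mul_pos ha hd
  have hacd : a * c ≤ a * c * d := Nat.le_mul_of_pos_right _ hd
  have habd : b * d ≤ b * d * a := Nat.le_mul_of_pos_right _ ha
  have haad : a * d ≤ a * d * a := Nat.le_mul_of_pos_right _ ha
  have hadd : a * d ≤ a * d * d := Nat.le_mul_of_pos_right _ hd
  have hbc : b * c ≤ b * c * a := Nat.le_mul_of_pos_right _ ha
  nlinarith [Nat.zero_le (b * c * b), Nat.zero_le (b * c * c), Nat.zero_le (b * c * d)]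

/-- Two nontrivial cuts of an `n`-set have more than a `1 / n` proportion of the pairs separated
by the first one in common. -/
lemma sum_cutIndicator_lt {V : Type*} [Fintype V] {S T : Finset V} (hS : S.Nonempty)
    (hS' : S ≠ univ) (hT : T.Nonempty) (hT' : T ≠ univ) :
    ∑ u, ∑ v, cutIndicator S u v <
      Fintype.card V * ∑ u, ∑ v, cutIndicator S u v * cutIndicator T u v := by
  classical
  set A : V → ℕ := fun u => if u ∈ S ∧ u ∈ T then 1 else 0
  set B : V → ℕ := fun u => if u ∈ S ∧ u ∉ T then 1 else 0
  set C : V → ℕ := fun u => if u ∉ S ∧ u ∈ T then 1 else 0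
  set D : V → ℕ := fun u => if u ∉ S ∧ u ∉ T then 1 else 0
  have hsep : ∀ u v, cutIndicator S u v =
      (((A u + B u) * (C v + D v) + (C u + D u) * (A v + B v) : ℕ) : ℝ) := by
    intro u v
    by_cases hu : u ∈ S <;> by_cases hv : v ∈ S <;> by_cases hu' : u ∈ T <;>
      by_cases hv' : v ∈ T <;> simp [cutIndicator, A, B, C, D, *]
  have hsep2 : ∀ u v, cutIndicator S u v * cutIndicator T u v =
      ((A u * D v + D u * A v + (B u * C v + C u * B v) : ℕ) : ℝ) := by
    intro u v
    by_cases hu : u ∈ S <;> by_cases hv : v ∈ S <;> by_cases hu' : u ∈ T <;>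
      by_cases hv' : v ∈ T <;> simp [cutIndicator, A, B, C, D, *]
  have hone : ∀ u, A u + B u + C u + D u = 1 := by
    intro u
    by_cases hu : u ∈ S <;> by_cases hu' : u ∈ T <;> simp [A, B, C, D, *]
  have hpos : ∀ {F : V → ℕ}, (∃ u, 0 < F u) → 0 < ∑ u, F u := fun ⟨u, hu⟩ =>
    Finset.sum_pos' (fun _ _ => Nat.zero_le _) ⟨u, mem_univ u, hu⟩
  obtain ⟨p, hp⟩ := hS
  obtain ⟨q, hq⟩ := hT
  obtain ⟨p', hp'⟩ : ∃ u, u ∉ S := by simpa [Finset.eq_univ_iff_forall] using hS'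
  obtain ⟨q', hq'⟩ : ∃ u, u ∉ T := by simpa [Finset.eq_univ_iff_forall] using hT'
  have hAB : 0 < ∑ u, (A u + B u) := hpos ⟨p, by by_cases p ∈ T <;> simp [A, B, *]⟩
  have hCD : 0 < ∑ u, (C u + D u) := hpos ⟨p', by by_cases p' ∈ T <;> simp [C, D, *]⟩
  have hAC : 0 < ∑ u, (A u + C u) := hpos ⟨q, by by_cases q ∈ S <;> simp [A, C, *]⟩
  have hBD : 0 < ∑ u, (B u + D u) := hpos ⟨q', by by_cases q' ∈ S <;> simp [B, D, *]⟩
  have hcard : ∑ u, (A u + B u + C u + D u) = Fintype.card V := by simp [hone]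
  simp only [Finset.sum_add_distrib] at hAB hCD hAC hBD hcard
  have hlt := add_mul_add_lt_of_pos hAB hCD hAC hBD
  simp only [hsep2]
  simp only [hsep]
  norm_cast
  simp only [Finset.sum_add_distrib, ← Finset.mul_sum, ← Finset.sum_mul]
  rw [← hcard]
  nlinarith [hlt]

lemma sum_cutIndicator_mul_le {V : Type*} [Fintype V] (G : SimpleGraph V) (S T : Finset V) :
    ∑ u, ∑ v, cutIndicator S u v * cutIndicator T u v ≤ cutWeight G S + cutWeight Gᶜ T := by
  classical
  simp only [cutWeight, ← Finset.sum_add_distrib]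
  refine Finset.sum_le_sum fun u _ => Finset.sum_le_sum fun v _ => ?_
  have hS := cutIndicator_nonneg S u v
  have hT := cutIndicator_nonneg T u v
  have hS' := cutIndicator_le_one S u v
  have hT' := cutIndicator_le_one T u v
  rcases eq_or_ne u v with rfl | huv
  · simp [cutIndicator_self]
  by_cases h : G.Adj u v
  · simp only [SimpleGraph.compl_adj, h, not_true_eq_false, and_false, if_true, if_false]
    nlinarith
  · simp only [SimpleGraph.compl_adj, h, huv, ne_eq, not_false_eq_true, and_self, if_true, if_false]
    nlinarith

lemma sum_cutIndicator_pos {V : Type*} [Fintype V] {S : Finset V} (hS : S.Nonempty)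
    (hS' : S ≠ univ) : 0 < ∑ u, ∑ v, cutIndicator S u v := by
  classical
  obtain ⟨p, hp⟩ := hS
  obtain ⟨q, hq⟩ : ∃ u, u ∉ S := by simpa [Finset.eq_univ_iff_forall] using hS'
  refine Finset.sum_pos' (fun u _ => Finset.sum_nonneg fun v _ => cutIndicator_nonneg S u v)
    ⟨p, mem_univ p, Finset.sum_pos' (fun v _ => cutIndicator_nonneg S p v) ⟨q, mem_univ q, ?_⟩⟩
  simp [cutIndicator, hp, hq]

/-- The `ℓ1`-Fiedler value is bounded below by the normalised density of some nontrivial cut. -/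
lemma exists_cut_le_l1Fiedler {V : Type*} [Fintype V] [Nontrivial V] (G : SimpleGraph V) :
    ∃ S : Finset V, S.Nonempty ∧ S ≠ univ ∧
      cutWeight G S / (∑ u, ∑ v, cutIndicator S u v) * Fintype.card V / 2 ≤ l1Fiedler G := by
  classical
  obtain ⟨p, q, hpq⟩ := exists_pair_ne V
  have hne : (univ.filter fun S : Finset V => S.Nonempty ∧ S ≠ univ).Nonempty := by
    refine ⟨{p}, ?_⟩
    simp only [mem_filter, mem_univ, true_and, singleton_nonempty]
    intro h
    exact hpq.symm (mem_singleton.1 (h ▸ mem_univ q))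
  obtain ⟨S, hS, hmin⟩ := Finset.exists_min_image _
    (fun S : Finset V => cutWeight G S / ∑ u, ∑ v, cutIndicator S u v) hne
  simp only [mem_filter, mem_univ, true_and] at hS hmin
  refine ⟨S, hS.1, hS.2, le_l1Fiedler_of_cuts G
    (div_nonneg (cutWeight_nonneg G S) (sum_cutIndicator_pos hS.1 hS.2).le) fun T => ?_⟩
  by_cases hT : T.Nonempty ∧ T ≠ univ
  · exact (le_div_iff₀ (sum_cutIndicator_pos hT.1 hT.2)).1 (hmin T hT)
  · have hzero : ∀ u v, cutIndicator T u v = 0 := by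
      intro u v
      rcases T.eq_empty_or_nonempty with rfl | hT0
      · simp [cutIndicator]
      · obtain rfl : T = univ := by by_contra h; exact hT ⟨hT0, h⟩
        simp [cutIndicator]
    simp [hzero, cutWeight_nonneg]

/-- For a connected graph `G` on `n ≥ 2` vertices,
`b(G) + b(Gᶜ) > 1/2`. -/
theorem stmt3 {V : Type*} [Fintype V] (G : SimpleGraph V) (hG : G.Connected)
    (hn : 2 ≤ Fintype.card V) :
    l1Fiedler G + l1Fiedler Gᶜ > 1 / 2 := by
  have : Nontrivial V := Fintype.one_lt_card_iff_nontrivial.1 hn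
  obtain ⟨S, hS, hS', hGS⟩ := exists_cut_le_l1Fiedler G
  obtain ⟨T, hT, hT', hGT⟩ := exists_cut_le_l1Fiedler Gᶜ
  have hlt₁ := sum_cutIndicator_lt hS hS' hT hT'
  have hlt₂ := sum_cutIndicator_lt hT hT' hS hS'
  simp only [mul_comm (cutIndicator T _ _)] at hlt₂
  have hle := sum_cutIndicator_mul_le G S T
  have hKS := sum_cutIndicator_pos hS hS'
  have hKT := sum_cutIndicator_pos hT hT'
  have hWS := cutWeight_nonneg G S
  have hWT := cutWeight_nonneg Gᶜ T
  set KS := ∑ u, ∑ v, cutIndicator S u v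
  set KT := ∑ u, ∑ v, cutIndicator T u v
  set n : ℝ := (Fintype.card V : ℝ) with hn_def
  have hn0 : 0 < n := by rw [hn_def]; exact_mod_cast (by omega : 0 < Fintype.card V)
  have hM : 0 < max KS KT := lt_max_of_lt_left hKS
  have h₁ : cutWeight G S / max KS KT ≤ cutWeight G S / KS :=
    div_le_div_of_nonneg_left hWS hKS (le_max_left _ _)
  have h₂ : cutWeight Gᶜ T / max KS KT ≤ cutWeight Gᶜ T / KT :=
    div_le_div_of_nonneg_left hWT hKT (le_max_right _ _)
  have h₃ : 1 < n * ((cutWeight G S + cutWeight Gᶜ T) / max KS KT) := by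
    rw [← mul_div_assoc, one_lt_div hM]
    exact (max_lt hlt₁ hlt₂).trans_le (mul_le_mul_of_nonneg_left hle hn0.le)
  rw [add_div] at h₃
  have h₄ := mul_le_mul_of_nonneg_left (add_le_add h₁ h₂) hn0.le
  linarith
end

section
/- Let T = (V, E) be a tree on n ≥ 2 vertices and let uv ∈ E. Then b(T) = (1/2)·(1/|V_u| + 1/|V_v|) if and only if uv is a centre edge of T. -/
open Finset

/-- The number of vertices of the component of `G - uv` containing `u`, i.e. `|V_u|`. -/
noncomputable def sideCard {V : Type*} [Fintype V] (G : SimpleGraph V) (u v : V) : ℕ :=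
  Nat.card {w : V | (G.deleteEdges {s(u, v)}).Reachable u w}
/-- `uv` is a centre edge of `T`: it is an edge minimizing `| |V_u| - |V_v| |`
over all edges of `T`. -/
def IsCentreEdge {V : Type*} [Fintype V] (T : SimpleGraph V) (u v : V) : Prop :=
  T.Adj u v ∧ ∀ a b, T.Adj a b →
    |(sideCard T u v : ℤ) - (sideCard T v u : ℤ)| ≤
      |(sideCard T a b : ℤ) - (sideCard T b a : ℤ)|

/-- The vertices of the component of `G - uv` containing `u`. -/
noncomputable def sideFinset {V : Type*} [Fintype V] (G : SimpleGraph V) (u v : V) : Finset V :=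
  {w : V | (G.deleteEdges {s(u, v)}).Reachable u w}.toFinite.toFinset

/-- A function that agrees on adjacent vertices of a connected graph is constant. -/
lemma eq_of_connected {V α : Type*} {G : SimpleGraph V} (hG : G.Connected) {f : V → α}
    (hf : ∀ p q, G.Adj p q → f p = f q) (p q : V) : f p = f q := by
  obtain ⟨w⟩ := hG.preconnected p q
  induction w with
  | nil => rfl
  | cons h _ ih => exact (hf _ _ h).trans ih

section

variable {V : Type*} [Fintype V] {G T : SimpleGraph V} {u v p q : V}

lemma mem_sideFinset {w : V} :
    w ∈ sideFinset G u v ↔ (G.deleteEdges {s(u, v)}).Reachable u w := by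
  simp [sideFinset]

lemma card_sideFinset : #(sideFinset G u v) = sideCard G u v :=
  (Nat.card_eq_card_finite_toFinset _).symm

lemma left_mem_sideFinset : u ∈ sideFinset G u v :=
  mem_sideFinset.2 (SimpleGraph.Reachable.refl u)

/-- Only the edge `uv` leaves the `u`-side of `uv`. -/
lemma mem_sideFinset_iff_of_adj (hpq : G.Adj p q) (hne : s(p, q) ≠ s(u, v)) :
    p ∈ sideFinset G u v ↔ q ∈ sideFinset G u v := by
  have h : (G.deleteEdges {s(u, v)}).Adj p q := by
    simpa [SimpleGraph.deleteEdges_adj, hpq] using hne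
  simp only [mem_sideFinset]
  exact ⟨fun hp => hp.trans h.reachable, fun hq => hq.trans h.symm.reachable⟩

lemma right_notMem_sideFinset (hT : T.IsTree) (huv : T.Adj u v) : v ∉ sideFinset T u v := by
  rw [mem_sideFinset]
  exact SimpleGraph.isBridge_iff.1 (SimpleGraph.isAcyclic_iff_forall_adj_isBridge.1 hT.isAcyclic huv)

lemma compl_sideFinset [DecidableEq V] (hT : T.IsTree) (huv : T.Adj u v) :
    (sideFinset T u v)ᶜ = sideFinset T v u := by
  ext w
  have key := eq_of_connected (f := fun w => (w ∉ sideFinset T u v ↔ w ∈ sideFinset T v u))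
    hT.connected (fun p q hpq => ?_) w u
  · rw [mem_compl, key]
    simp [left_mem_sideFinset, right_notMem_sideFinset hT huv.symm]
  · by_cases h : s(p, q) = s(u, v)
    · have h1 := right_notMem_sideFinset hT huv
      have h2 := right_notMem_sideFinset hT huv.symm
      have h3 := left_mem_sideFinset (G := T) (u := u) (v := v)
      have h4 := left_mem_sideFinset (G := T) (u := v) (v := u)
      rcases Sym2.eq_iff.1 h with ⟨rfl, rfl⟩ | ⟨rfl, rfl⟩ <;> simp [h1, h2, h3, h4]
    · simp only [mem_sideFinset_iff_of_adj hpq h,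
        mem_sideFinset_iff_of_adj hpq (fun h' => h (h'.trans Sym2.eq_swap))]

lemma sideCard_pos : 0 < sideCard G u v :=
  card_sideFinset (G := G) ▸ card_pos.2 ⟨u, left_mem_sideFinset⟩

lemma sideCard_add_sideCard (hT : T.IsTree) (huv : T.Adj u v) :
    sideCard T u v + sideCard T v u = Fintype.card V := by
  classical
  rw [← card_sideFinset, ← card_sideFinset, ← compl_sideFinset hT huv, card_add_card_compl]

lemma sum_sum_eq_of_forall_ne {M : Type*} [AddCommMonoid M] {F : V → V → M} (huv : u ≠ v)
    (hF : ∀ p q, s(p, q) ≠ s(u, v) → F p q = 0) : ∑ p, ∑ q, F p q = F u v + F v u := by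
  classical
  rw [← Fintype.sum_prod_type' F, ← sum_pair (f := fun z : V × V => F z.1 z.2)
    (a := (u, v)) (b := (v, u)) (by simp [huv])]
  symm
  refine sum_subset (subset_univ _) fun z _ hz => hF _ _ fun h => hz ?_
  rcases Sym2.eq_iff.1 h with ⟨h1, h2⟩ | ⟨h1, h2⟩ <;> simp [Prod.ext_iff, h1, h2]

open Classical in
/-- Summation by parts on a tree. -/
lemma sum_mul_eq_sum_adj (hT : T.IsTree) {g : V → ℝ} (hg : ∑ w, g w = 0) (x : V → ℝ) :
    ∑ w, g w * x w =
      (1 / 2) * ∑ u, ∑ v, if T.Adj u v then (x u - x v) * ∑ w ∈ sideFinset T u v, g w else 0 := by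
  set h : V → ℝ := fun w => x w -
    (1 / 2) * ∑ u, ∑ v, if T.Adj u v ∧ w ∈ sideFinset T u v then x u - x v else 0 with h_def
  obtain ⟨r⟩ := hT.connected.nonempty
  have hconst : ∀ w, h w = h r := fun w => by
    refine eq_of_connected hT.connected (fun p q hpq => ?_) w r
    have hsum := sum_sum_eq_of_forall_ne (u := p) (v := q) (F := fun u v =>
      (if T.Adj u v ∧ p ∈ sideFinset T u v then x u - x v else 0) -
        (if T.Adj u v ∧ q ∈ sideFinset T u v then x u - x v else 0)) hpq.ne
      (fun u v hne => by simp only [mem_sideFinset_iff_of_adj hpq hne.symm, sub_self])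
    simp only [sum_sub_distrib, hpq, hpq.symm, left_mem_sideFinset,
      right_notMem_sideFinset hT hpq, right_notMem_sideFinset hT hpq.symm, and_self, and_false,
      if_true, if_false] at hsum
    simp only [h_def]
    linarith
  have hx : ∀ w, x w = h r +
      (1 / 2) * ∑ u, ∑ v, if T.Adj u v ∧ w ∈ sideFinset T u v then x u - x v else 0 := fun w => by
    rw [← hconst w]; simp [h_def]
  have hsplit : ∑ w, g w * x w = (∑ w, g w) * h r + (1 / 2) * ∑ w, ∑ u, ∑ v,
      if T.Adj u v ∧ w ∈ sideFinset T u v then (x u - x v) * g w else 0 := by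
    rw [sum_mul, mul_sum, ← sum_add_distrib]
    refine sum_congr rfl fun w _ => ?_
    rw [hx w, mul_add, mul_left_comm, mul_sum]
    congr 2
    refine sum_congr rfl fun u _ => ?_
    rw [mul_sum]
    refine sum_congr rfl fun v _ => ?_
    rw [mul_ite, mul_zero, mul_comm]
  rw [hsplit, hg, zero_mul, zero_add, sum_comm]
  congr 1
  refine sum_congr rfl fun u _ => ?_
  rw [sum_comm]
  refine sum_congr rfl fun v _ => ?_
  split_ifs with huv <;> simp [huv, mul_sum]

/-- A `±1`-valued function, centred at its mean, has small sum over each side of an edge. -/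
lemma abs_sum_sideFinset_sub_le (hT : T.IsTree) (huv : T.Adj u v) {s : V → ℝ}
    (hs : ∀ w, |s w| ≤ 1) :
    |∑ w ∈ sideFinset T u v, ((Fintype.card V : ℝ) * s w - ∑ z, s z)| ≤
      2 * ((sideCard T u v : ℝ) * sideCard T v u) := by
  classical
  have hle : ∀ A : Finset V, |∑ w ∈ A, s w| ≤ #A := fun A =>
    (abs_sum_le_sum_abs _ _).trans ((sum_le_sum fun w _ => hs w).trans (by simp))
  have h1 := hle (sideFinset T u v)
  have h2 := hle (sideFinset T v u)
  have htot := sum_add_sum_compl (sideFinset T u v) s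
  rw [compl_sideFinset hT huv] at htot
  rw [sum_sub_distrib, ← mul_sum, sum_const, nsmul_eq_mul, ← htot,
    ← sideCard_add_sideCard hT huv]
  simp only [card_sideFinset] at h1 h2 ⊢
  rw [abs_le] at h1 h2 ⊢
  have ha : (0 : ℝ) ≤ sideCard T u v := Nat.cast_nonneg _
  have hb : (0 : ℝ) ≤ sideCard T v u := Nat.cast_nonneg _
  push_cast
  constructor <;> nlinarith

open Classical in
lemma card_le_mul_energy (hT : T.IsTree) {M : ℝ}
    (hM : ∀ p q, T.Adj p q → (sideCard T p q : ℝ) * sideCard T q p ≤ M) {x : V → ℝ}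
    (hx0 : ∑ w, x w = 0) (hx1 : ∑ w, |x w| = 1) :
    (Fintype.card V : ℝ) ≤
      2 * M * ((1 / 2) * ∑ u, ∑ v, if T.Adj u v then |x u - x v| else 0) := by
  set s : V → ℝ := fun w => SignType.sign (x w) with s_def
  have hs : ∀ w, |s w| ≤ 1 := fun w => by
    rcases lt_trichotomy (x w) 0 with h | h | h <;> simp [s_def, h]
  have hparts := sum_mul_eq_sum_adj hT
    (g := fun w => (Fintype.card V : ℝ) * s w - ∑ z, s z)
    (by rw [sum_sub_distrib, ← mul_sum, sum_const, nsmul_eq_mul, card_univ, sub_self]) x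
  have hlhs : ∑ w, ((Fintype.card V : ℝ) * s w - ∑ z, s z) * x w = Fintype.card V := by
    simp only [sub_mul, mul_assoc, sum_sub_distrib, ← mul_sum, hx0, s_def, sign_mul_self, hx1]
    simp
  rw [← hlhs, hparts, mul_left_comm (2 * M)]
  refine mul_le_mul_of_nonneg_left ?_ (by norm_num)
  simp only [mul_sum (a := 2 * M)]
  refine sum_le_sum fun u _ => sum_le_sum fun v _ => ?_
  split_ifs with huv
  · refine (le_abs_self _).trans ?_
    rw [abs_mul, mul_comm]
    gcongr
    exact (abs_sum_sideFinset_sub_le hT huv hs).trans (by linarith [hM u v huv])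
  · simp

open Classical in
/-- The vector taking one value on each side of `uv` shows that
`(1/2) (1/|V_u| + 1/|V_v|)` is attained. -/
lemma exists_energy_eq (hT : T.IsTree) (huv : T.Adj u v) :
    ∃ x : V → ℝ, (∑ w, x w) = 0 ∧ (∑ w, |x w|) = 1 ∧
      (1 / 2) * (1 / (sideCard T u v : ℝ) + 1 / (sideCard T v u : ℝ)) =
        (1 / 2) * ∑ p, ∑ q, if T.Adj p q then |x p - x q| else 0 := by
  have ha : (0 : ℝ) < sideCard T u v := Nat.cast_pos.2 sideCard_pos
  have hb : (0 : ℝ) < sideCard T v u := Nat.cast_pos.2 sideCard_pos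
  have hsum : ∀ c d : ℝ, ∑ w, (if w ∈ sideFinset T u v then c else d) =
      sideCard T u v * c + sideCard T v u * d := fun c d => by
    rw [sum_ite, ← card_sideFinset, ← card_sideFinset, ← compl_sideFinset hT huv, compl_eq_univ_sdiff,
      sdiff_eq_filter]
    simp
  refine ⟨fun w => if w ∈ sideFinset T u v then 1 / (2 * (sideCard T u v : ℝ))
    else -(1 / (2 * (sideCard T v u : ℝ))), ?_, ?_, ?_⟩
  · rw [hsum]
    field_simp
    ring
  · simp only [apply_ite abs]
    rw [hsum, abs_neg, abs_of_pos (by positivity), abs_of_pos (by positivity)]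
    field_simp
    ring
  · rw [sum_sum_eq_of_forall_ne huv.ne]
    · have hpos : 0 < 1 / (2 * (sideCard T u v : ℝ)) + 1 / (2 * (sideCard T v u : ℝ)) := by
        positivity
      simp only [huv, huv.symm, if_true, left_mem_sideFinset, right_notMem_sideFinset hT huv,
        if_false]
      rw [abs_sub_comm (-_) _, sub_neg_eq_add, abs_of_pos hpos]
      field_simp
      ring
    · intro p q hne
      split_ifs with hpq
      · simp only [mem_sideFinset_iff_of_adj hpq hne, sub_self, abs_zero]
      · rfl

lemma abs_sub_le_abs_sub_iff_mul_le {a b c d : ℕ} (h : a + b = c + d) :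
    |(a : ℤ) - b| ≤ |(c : ℤ) - d| ↔ (c : ℝ) * d ≤ a * b := by
  rw [← sq_le_sq]
  have h' : (a : ℤ) + b = c + d := by exact_mod_cast h
  have h2 : ((a : ℤ) + b) ^ 2 = (c + d) ^ 2 := by rw [h']
  have : (c : ℝ) * d ≤ a * b ↔ (c : ℤ) * d ≤ a * b := by norm_cast
  rw [this]
  constructor <;> intro <;> linarith

lemma half_inv_add_inv {a b n : ℕ} (ha : 0 < a) (hb : 0 < b) (h : a + b = n) :
    (1 / 2) * (1 / (a : ℝ) + 1 / (b : ℝ)) = n / (2 * ((a : ℝ) * b)) := by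
  subst h
  push_cast
  field_simp
  ring

end

/-- For a tree `T` on `n ≥ 2` vertices and an edge `uv` of `T`,
`b(T) = (1/2) (1/|V_u| + 1/|V_v|)` iff `uv` is a centre edge of `T`. -/
theorem stmt4 {V : Type*} [Fintype V] (T : SimpleGraph V) (hT : T.IsTree)
    (hn : 2 ≤ Fintype.card V) (u v : V) (huv : T.Adj u v) :
    l1Fiedler T = (1 / 2) * (1 / (sideCard T u v : ℝ) + 1 / (sideCard T v u : ℝ)) ↔
      IsCentreEdge T u v := by
  have hedge : ∀ {p q}, T.Adj p q →
      (1 / 2) * (1 / (sideCard T p q : ℝ) + 1 / (sideCard T q p : ℝ)) =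
        Fintype.card V / (2 * ((sideCard T p q : ℝ) * sideCard T q p)) := fun hpq =>
    half_inv_add_inv sideCard_pos sideCard_pos (sideCard_add_sideCard hT hpq)
  have hprod : ∀ p q, 0 < (sideCard T p q : ℝ) * sideCard T q p := fun p q =>
    mul_pos (Nat.cast_pos.2 sideCard_pos) (Nat.cast_pos.2 sideCard_pos)
  have hn0 : (0 : ℝ) < Fintype.card V := by exact_mod_cast (by omega : 0 < Fintype.card V)
  have hcentre : IsCentreEdge T u v ↔ ∀ p q, T.Adj p q →
      (sideCard T p q : ℝ) * sideCard T q p ≤ sideCard T u v * sideCard T v u := by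
    refine (and_iff_right huv).trans (forall₂_congr fun p q => forall_congr' fun hpq => ?_)
    exact abs_sub_le_abs_sub_iff_mul_le
      ((sideCard_add_sideCard hT huv).trans (sideCard_add_sideCard hT hpq).symm)
  rw [hcentre]
  constructor
  · intro hb p q hpq
    have hle : l1Fiedler T ≤ _ := csInf_le
      ⟨0, by
        rintro y ⟨x, -, -, rfl⟩
        refine mul_nonneg (by norm_num) (sum_nonneg fun a _ => sum_nonneg fun b _ => ?_)
        split_ifs <;> positivity⟩ (exists_energy_eq hT hpq)
    rw [hb, hedge huv, hedge hpq, div_le_div_iff_of_pos_left hn0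
      (mul_pos two_pos (hprod u v)) (mul_pos two_pos (hprod p q))] at hle
    linarith
  · intro hM
    refine IsLeast.csInf_eq ⟨exists_energy_eq hT huv, ?_⟩
    rintro y ⟨x, hx0, hx1, rfl⟩
    rw [hedge huv, div_le_iff₀' (mul_pos two_pos (hprod u v))]
    exact card_le_mul_energy hT hM hx0 hx1
end

section
/- Let T be a tree on n ≥ 2 vertices. Then b(T) ≤ n/(2(n−1)), and equality holds if and only if T is isomorphic to the star graph S_n (the tree with one centre vertex adjacent to the other n−1 vertices). In particular, among all trees on n vertices, the star S_n is the unique maximizer of b(T). -/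
open Finset

namespace SimpleGraph

variable {V : Type*} {G : SimpleGraph V}

/-- A connected graph in which every edge has an end of degree one is a star. -/
theorem Connected.exists_eq_starGraph [Nontrivial V] (hG : G.Connected)
    (h : ∀ u v, G.Adj u v → (∀ w, G.Adj u w → w = v) ∨ ∀ w, G.Adj v w → w = u) :
    ∃ c, G = starGraph c := by
  obtain ⟨a, b, hab, ha⟩ : ∃ a b, G.Adj a b ∧ ∀ w, G.Adj a w → w = b := by
    obtain ⟨x⟩ := hG.nonempty
    obtain ⟨y, hxy⟩ := hG.preconnected.exists_adj_of_nontrivial x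
    rcases h x y hxy with hx | hy
    · exact ⟨x, y, hxy, hx⟩
    · exact ⟨y, x, hxy.symm, hy⟩
  have key : ∀ w z, G.Adj b w → G.Adj w z → z = b := by
    intro w z hw hz
    rcases h b w hw with hb | hw'
    · obtain rfl := hb a hab.symm
      exact ha z hz
    · exact hw' z hz
  have hall : ∀ v, v = b ∨ G.Adj b v := by
    intro v
    obtain ⟨p⟩ := hG.preconnected v b
    induction p with
    | nil => exact Or.inl rfl
    | cons hadj _ ih =>
      rcases ih hab ha key with rfl | hw
      · exact Or.inr hadj.symm
      · exact Or.inl (key _ _ hw hadj.symm)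
  refine ⟨b, ?_⟩
  ext u v
  rw [starGraph_adj]
  refine ⟨fun huv => ⟨huv.ne, ?_⟩, ?_⟩
  · rcases hall u with hu | hu
    · exact Or.inl hu
    · exact Or.inr (key _ _ hu huv)
  · rintro ⟨hne, rfl | rfl⟩
    · exact (hall v).resolve_left hne.symm
    · exact ((hall u).resolve_left hne).symm

theorem nonempty_starGraph_iso_completeBipartiteGraph [Fintype V] (c : V) :
    Nonempty (starGraph c ≃g completeBipartiteGraph (Fin 1) (Fin (Fintype.card V - 1))) := by
  classical
  have hcard : Fintype.card {v // ¬ v = c} = Fintype.card V - 1 := by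
    rw [Fintype.card_subtype_compl, Fintype.card_subtype_eq]
  let e : V ≃ Fin 1 ⊕ Fin (Fintype.card V - 1) :=
    (Equiv.sumCompl (· = c)).symm.trans
      (Equiv.sumCongr (Equiv.ofUnique _ _) (Fintype.equivFinOfCardEq hcard))
  have hleft : ∀ v, (e v).isLeft = true ↔ v = c := by
    intro v
    by_cases hv : v = c
    · simp [e, hv]
    · simp [e, hv]
  have hright : ∀ v, (e v).isRight = true ↔ v ≠ c := by
    intro v
    rw [← Sum.not_isLeft, ne_eq, ← hleft]
  refine ⟨⟨e, fun {u v} => ?_⟩⟩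
  rw [completeBipartiteGraph_adj, hleft, hleft, hright, hright, starGraph_adj]
  grind

theorem exists_eq_starGraph_of_iso {m : ℕ} (e : G ≃g completeBipartiteGraph (Fin 1) (Fin m)) :
    ∃ c, G = starGraph c := by
  refine ⟨e.symm (Sum.inl 0), ?_⟩
  ext u v
  have hiff : ∀ w, w = e.symm (Sum.inl 0) ↔ e w = Sum.inl 0 := fun w =>
    e.toEquiv.eq_symm_apply
  rw [← e.map_adj_iff, starGraph_adj, completeBipartiteGraph_adj, hiff, hiff, ← e.injective.ne_iff]
  rcases e u with i | i <;> rcases e v with j | j <;> simp [Subsingleton.elim _ (0 : Fin 1)]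

/-- Deleting a bridge `uv` separates a vertex set containing `u` from its complement, which
contains `v`, and every other edge at `u` or `v` stays on its side. -/
theorem IsBridge.exists_cut {u v : V} (huv : G.Adj u v) (hb : G.IsBridge s(u, v)) :
    ∃ S : Set V, (u ∈ S ∧ v ∉ S) ∧
      (∀ a b, G.Adj a b → a ∈ S → b ∉ S → a = u ∧ b = v) ∧
      (∀ w, G.Adj u w → w ≠ v → w ∈ S) ∧ (∀ w, G.Adj v w → w ≠ u → w ∉ S) := by
  have hv : ¬ (G.deleteEdges {s(u, v)}).Reachable u v := isBridge_iff.1 hb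
  have step : ∀ a b, G.Adj a b → s(a, b) ≠ s(u, v) →
      (G.deleteEdges {s(u, v)}).Reachable u a → (G.deleteEdges {s(u, v)}).Reachable u b :=
    fun a b hab hne ha => ha.trans (Adj.reachable (by simpa [deleteEdges_adj, hab] using hne))
  refine ⟨{w | (G.deleteEdges {s(u, v)}).Reachable u w}, ⟨Reachable.refl _, hv⟩, ?_, ?_, ?_⟩
  · intro a b hab ha hb'
    by_contra hne
    refine hb' (step a b hab (fun h => ?_) ha)
    rcases Sym2.eq_iff.1 h with h | ⟨rfl, rfl⟩
    · exact hne h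
    · exact hv ha
  · intro w hw hne
    exact step u w hw (by grind [Sym2.eq_iff]) (Reachable.refl _)
  · intro w hw hne hS
    exact hv (step w v hw.symm (by grind [Sym2.eq_iff]) hS)

end SimpleGraph

section l1Fiedler

variable {V : Type*} [Fintype V] {G : SimpleGraph V}

open Classical in
theorem l1Fiedler_le_s5 {x : V → ℝ} (hsum : ∑ v, x v = 0) (habs : ∑ v, |x v| = 1) :
    l1Fiedler G ≤ (1 / 2) * ∑ u, ∑ v, if G.Adj u v then |x u - x v| else 0 := by
  refine csInf_le ⟨0, ?_⟩ ⟨x, hsum, habs, rfl⟩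
  rintro _ ⟨z, -, -, rfl⟩
  refine mul_nonneg (by norm_num) (sum_nonneg fun u _ => sum_nonneg fun v _ => ?_)
  split_ifs <;> positivity

/-- The function with constant values of opposite sign on `S` and `Sᶜ` satisfying the constraints
in the definition of `l1Fiedler`. -/
theorem sum_ite_mem_card_inv [DecidableEq V] {S : Finset V} (hS : S.Nonempty)
    (hSc : Sᶜ.Nonempty) :
    (∑ v, if v ∈ S then 1 / (2 * (#S : ℝ)) else -(1 / (2 * (#Sᶜ : ℝ)))) = 0 ∧
    (∑ v, |if v ∈ S then 1 / (2 * (#S : ℝ)) else -(1 / (2 * (#Sᶜ : ℝ)))|) = 1 := by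
  have h1 : (0 : ℝ) < #S := by exact_mod_cast hS.card_pos
  have h2 : (0 : ℝ) < #Sᶜ := by exact_mod_cast hSc.card_pos
  constructor <;> rw [← sum_add_sum_compl S]
  · rw [sum_congr rfl fun v hv => if_pos hv,
      sum_congr (s₁ := Sᶜ) rfl fun v hv => if_neg (mem_compl.1 hv)]
    simp only [sum_const, nsmul_eq_mul]
    field_simp
    norm_num
  · rw [sum_congr rfl fun v hv => by rw [if_pos hv, abs_of_pos (by positivity)],
      sum_congr (s₁ := Sᶜ) rfl fun v hv => by
        rw [if_neg (mem_compl.1 hv), abs_neg, abs_of_pos (by positivity)]]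
    simp only [sum_const, nsmul_eq_mul]
    field_simp
    norm_num

open Classical in
theorem l1Fiedler_le_of_cut {S : Finset V} {u v : V} (hu : u ∈ S) (hv : v ∉ S)
    (hcut : ∀ a b, G.Adj a b → a ∈ S → b ∉ S → a = u ∧ b = v) :
    l1Fiedler G ≤ (Fintype.card V : ℝ) / (2 * (#S * (Fintype.card V - #S))) := by
  have hSc : Sᶜ.Nonempty := ⟨v, mem_compl.2 hv⟩
  have h1 : (0 : ℝ) < #S := by exact_mod_cast card_pos.2 ⟨u, hu⟩
  have h2 : (0 : ℝ) < #Sᶜ := by exact_mod_cast hSc.card_pos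
  have hcard : (#S : ℝ) + #Sᶜ = Fintype.card V := by exact_mod_cast S.card_add_card_compl
  obtain ⟨hsum, habs⟩ := sum_ite_mem_card_inv ⟨u, hu⟩ hSc
  refine (l1Fiedler_le_s5 hsum habs).trans ?_
  set C : ℝ := 1 / (2 * (#S : ℝ)) + 1 / (2 * (#Sᶜ : ℝ)) with hC
  have hC0 : 0 ≤ C := by positivity
  have hC' : |-(1 / (2 * (#Sᶜ : ℝ))) - 1 / (2 * (#S : ℝ))| = C := by
    rw [abs_sub_comm, sub_neg_eq_add, abs_of_nonneg hC0]
  calc _ ≤ (1 / 2 : ℝ) * ∑ a, ∑ b,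
        ((if a = u then if b = v then C else 0 else 0) +
          if a = v then if b = u then C else 0 else 0) := by
        gcongr with a _ b _
        by_cases hab : G.Adj a b
        · rw [if_pos hab]
          by_cases ha : a ∈ S <;> by_cases hb : b ∈ S
          · simp only [ha, hb, if_true, sub_self, abs_zero]
            split_ifs <;> linarith
          · obtain ⟨rfl, rfl⟩ := hcut a b hab ha hb
            simp only [ha, hb, if_true, if_false, sub_neg_eq_add]
            rw [abs_of_nonneg hC0]
            split_ifs <;> linarith
          · obtain ⟨rfl, rfl⟩ := hcut b a hab.symm hb ha
            simp only [ha, hb, if_true, if_false, hC']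
            split_ifs <;> linarith
          · simp only [ha, hb, if_false, sub_self, abs_zero]
            split_ifs <;> linarith
        · rw [if_neg hab]
          split_ifs <;> linarith
    _ = C := by
        simp only [sum_add_distrib, sum_ite_eq', mem_univ, if_true, sum_ite_irrel, sum_const_zero]
        ring
    _ = _ := by
        rw [hC, ← hcard, add_sub_cancel_left]
        field_simp
        ring

theorem le_sum_abs_sub {x : V → ℝ} (c : V)
    (hn : 2 ≤ Fintype.card V) (hsum : ∑ v, x v = 0) (habs : ∑ v, |x v| = 1) (hc : 0 ≤ x c) :
    (Fintype.card V : ℝ) / (2 * ((Fintype.card V : ℝ) - 1)) ≤ ∑ v, |x v - x c| := by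
  classical
  have hn' : (2 : ℝ) ≤ Fintype.card V := by exact_mod_cast hn
  obtain ⟨w, hwc, hw⟩ : ∃ w, w ≠ c ∧ x w ≤ 0 := by
    by_contra! hpos
    obtain ⟨w, hw⟩ := Fintype.exists_ne_of_one_lt_card hn c
    refine (sum_pos' (s := univ) (f := x) (fun v _ => ?_) ⟨w, mem_univ w, hpos w hw⟩).ne' hsum
    by_cases hv : v = c
    · exact hv ▸ hc
    · exact (hpos v hv).le
  set L : ℝ := (Fintype.card V : ℝ) - 1 with hL
  have hL1 : 1 ≤ L := by linarith
  have hLi : L⁻¹ ≤ 1 := inv_le_one_of_one_le₀ hL1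
  have hLi0 : 0 < L⁻¹ := by positivity
  have hterm : ∀ v, (|x v| - x v) / 2 + L⁻¹ * ((|x v| + x v) / 2 - x c) +
      (if v = w then x c + L⁻¹ * x c else 0) ≤ |x v - x c| := by
    intro v
    rcases le_total (x v) 0 with hv | hv
    · rw [abs_of_nonpos hv, abs_of_nonpos (by linarith : x v - x c ≤ 0)]
      split_ifs <;> nlinarith
    · rw [abs_of_nonneg hv]
      split_ifs with hvw
      · obtain rfl := hvw
        have h0 : x v = 0 := le_antisymm hw hv
        rw [h0, zero_sub (x c), abs_neg, abs_of_nonneg hc]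
        linarith
      · have h1 : L⁻¹ * (x v - x c) ≤ |x v - x c| := by
          refine (le_abs_self _).trans ?_
          rw [abs_mul, abs_of_pos hLi0]
          exact mul_le_of_le_one_left (abs_nonneg _) hLi
        linarith
  refine le_trans (le_of_eq ?_) (sum_le_sum fun v _ => hterm v)
  rw [sum_add_distrib, sum_add_distrib, ← mul_sum, sum_sub_distrib, ← sum_div, ← sum_div,
    sum_sub_distrib, sum_add_distrib, hsum, habs, sum_ite_eq' univ w]
  simp only [mem_univ, if_true, sum_const, card_univ, nsmul_eq_mul]
  rw [show (Fintype.card V : ℝ) = L + 1 by rw [hL]; ring]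
  field_simp
  ring

theorem SimpleGraph.sum_starGraph_adj (c : V) [DecidableRel (starGraph c).Adj] (x : V → ℝ) :
    ((1 / 2) * ∑ u, ∑ v, if (starGraph c).Adj u v then |x u - x v| else 0) =
      ∑ v, |x v - x c| := by
  classical
  have hterm : ∀ u v, (if (starGraph c).Adj u v then |x u - x v| else 0) =
      (if u = c then |x v - x c| else 0) + if v = c then |x u - x c| else 0 := by
    intro u v
    by_cases hu : u = c <;> by_cases hv : v = c
    · simp [hu, hv]
    · simp [hu, hv, Ne.symm hv, abs_sub_comm]
    · simp [hu, hv]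
    · simp [hu, hv]
  simp only [hterm, sum_add_distrib, sum_ite_eq', mem_univ, if_true, sum_ite_irrel, sum_const_zero]
  ring

theorem le_l1Fiedler_starGraph (c : V) (hn : 2 ≤ Fintype.card V) :
    (Fintype.card V : ℝ) / (2 * ((Fintype.card V : ℝ) - 1)) ≤
      l1Fiedler (SimpleGraph.starGraph c) := by
  classical
  obtain ⟨w, hw⟩ := Fintype.exists_ne_of_one_lt_card hn c
  obtain ⟨hsum, habs⟩ := sum_ite_mem_card_inv (singleton_nonempty c)
    ⟨w, by simpa using hw⟩
  refine le_csInf ⟨_, _, hsum, habs, rfl⟩ ?_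
  rintro _ ⟨x, hx, hx', rfl⟩
  rw [@SimpleGraph.sum_starGraph_adj _ _ c (fun _ _ => Classical.propDecidable _)]
  rcases le_total 0 (x c) with hc | hc
  · exact le_sum_abs_sub c hn hx hx' hc
  · have h := le_sum_abs_sub (x := -x) c hn (by simpa using hx) (by simpa using hx')
      (by simpa using hc)
    refine h.trans_eq (sum_congr rfl fun v _ => ?_)
    rw [Pi.neg_apply, Pi.neg_apply, neg_sub_neg, abs_sub_comm]

/-- The bound on `l1Fiedler` given by the two sides of a bridge `uv`; `k` is the number of vertices
on the side of `u`. -/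
theorem SimpleGraph.l1Fiedler_le_of_isBridge {u v : V} (huv : G.Adj u v)
    (hb : G.IsBridge s(u, v)) :
    ∃ k : ℕ, 1 ≤ k ∧ k + 1 ≤ Fintype.card V ∧
      ((∃ w, G.Adj u w ∧ w ≠ v) → 2 ≤ k) ∧
      ((∃ w, G.Adj v w ∧ w ≠ u) → k + 2 ≤ Fintype.card V) ∧
      l1Fiedler G ≤ (Fintype.card V : ℝ) / (2 * (k * (Fintype.card V - k))) := by
  classical
  obtain ⟨S, ⟨hu, hv⟩, hcut, hSu, hSv⟩ := hb.exists_cut huv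
  have hcard := S.toFinset.card_add_card_compl
  refine ⟨#S.toFinset, card_pos.2 ⟨u, by simpa using hu⟩, ?_, ?_, ?_,
    l1Fiedler_le_of_cut (u := u) (v := v) (by simpa using hu) (by simpa using hv)
      (by simpa using hcut)⟩
  · have : 0 < #S.toFinsetᶜ := card_pos.2 ⟨v, by simpa using hv⟩
    omega
  · rintro ⟨w, hw, hne⟩
    exact one_lt_card.2 ⟨u, by simpa using hu, w, by simpa using hSu w hw hne, hw.ne⟩
  · rintro ⟨w, hw, hne⟩
    have : 1 < #S.toFinsetᶜ :=
      one_lt_card.2 ⟨v, by simpa using hv, w, by simpa using hSv w hw hne, hw.ne⟩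
    omega

end l1Fiedler

/-- For a tree `T` on `n ≥ 2` vertices, `b(T) ≤ n / (2(n-1))`, with
equality iff `T` is isomorphic to the star `S_n` (one centre vertex joined to the other
`n - 1` vertices). -/
theorem stmt5 {V : Type*} [Fintype V] (T : SimpleGraph V) (hT : T.IsTree)
    (hn : 2 ≤ Fintype.card V) :
    l1Fiedler T ≤ (Fintype.card V : ℝ) / (2 * ((Fintype.card V : ℝ) - 1)) ∧
    (l1Fiedler T = (Fintype.card V : ℝ) / (2 * ((Fintype.card V : ℝ) - 1)) ↔
      Nonempty (T ≃g completeBipartiteGraph (Fin 1) (Fin (Fintype.card V - 1)))) := by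
  have : Nontrivial V := Fintype.one_lt_card_iff_nontrivial.1 hn
  have hn' : (2 : ℝ) ≤ Fintype.card V := by exact_mod_cast hn
  have hle : ∀ u v, T.Adj u v → ∃ k : ℕ, 1 ≤ k ∧ k + 1 ≤ Fintype.card V ∧
      ((∃ w, T.Adj u w ∧ w ≠ v) → 2 ≤ k) ∧
      ((∃ w, T.Adj v w ∧ w ≠ u) → k + 2 ≤ Fintype.card V) ∧
      l1Fiedler T ≤ (Fintype.card V : ℝ) / (2 * (k * (Fintype.card V - k))) := fun u v huv =>
    SimpleGraph.l1Fiedler_le_of_isBridge huv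
      (SimpleGraph.isAcyclic_iff_forall_adj_isBridge.1 hT.isAcyclic huv)
  have hub : l1Fiedler T ≤ (Fintype.card V : ℝ) / (2 * ((Fintype.card V : ℝ) - 1)) := by
    obtain ⟨u⟩ := hT.connected.nonempty
    obtain ⟨v, huv⟩ := hT.connected.preconnected.exists_adj_of_nontrivial u
    obtain ⟨k, hk1, hk2, -, -, hk⟩ := hle u v huv
    have h1 : (1 : ℝ) ≤ k := by exact_mod_cast hk1
    have h2 : (k : ℝ) + 1 ≤ Fintype.card V := by exact_mod_cast hk2
    refine hk.trans ?_
    gcongr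
    · linarith
    · nlinarith
  refine ⟨hub, fun heq => ?_, fun ⟨e⟩ => le_antisymm hub ?_⟩
  · obtain ⟨c, rfl⟩ := hT.connected.exists_eq_starGraph fun u v huv => by
      by_contra! hcon
      obtain ⟨k, -, -, hk1, hk2, hk⟩ := hle u v huv
      have h1 : (2 : ℝ) ≤ k := by exact_mod_cast hk1 hcon.1
      have h2 : (k : ℝ) + 2 ≤ Fintype.card V := by exact_mod_cast hk2 hcon.2
      refine (hk.trans_lt ?_).ne heq
      refine div_lt_div_of_pos_left ?_ ?_ ?_ <;> nlinarith
    exact SimpleGraph.nonempty_starGraph_iso_completeBipartiteGraph c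
  · obtain ⟨c, rfl⟩ := SimpleGraph.exists_eq_starGraph_of_iso e
    exact le_l1Fiedler_starGraph c hn
end

section
/- Let uv be a centre edge of the path graph P_n = (V, E) with n ≥ 2, and let T′ = (V′, E′) be a tree obtained from P_n by attaching r new pendant vertices, each adjacent to either u or v. Then uv is a centre edge of T′. -/
open Finset

/-- The graph obtained from `G` by attaching `r` new pendant vertices, the `j`-th new
vertex being adjacent exactly to the vertex `f j` of `G`. -/
def attachPendants {V : Type*} (G : SimpleGraph V) {r : ℕ} (f : Fin r → V) :
    SimpleGraph (V ⊕ Fin r) :=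
  SimpleGraph.fromRel (fun a b =>
    (∃ x y, a = Sum.inl x ∧ b = Sum.inl y ∧ G.Adj x y) ∨
    (∃ j, b = Sum.inr j ∧ a = Sum.inl (f j)))

section AttachPendants

variable {V : Type*} {G : SimpleGraph V} {r : ℕ} {f : Fin r → V}

/-- The retraction of `attachPendants G f` onto `G` contracting all pendant edges. -/
def pendantRetract (f : Fin r → V) : V ⊕ Fin r → V := Sum.elim id f

lemma attachPendants_adj_inl_inl {x y : V} :
    (attachPendants G f).Adj (Sum.inl x) (Sum.inl y) ↔ G.Adj x y := by
  simp only [attachPendants, SimpleGraph.fromRel_adj]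
  constructor
  · rintro ⟨-, h⟩
    simpa [G.adj_comm y x] using h
  · intro h
    exact ⟨by simpa using h.ne, Or.inl (Or.inl ⟨x, y, rfl, rfl, h⟩)⟩

lemma attachPendants_adj_inl_inr {x : V} {j : Fin r} :
    (attachPendants G f).Adj (Sum.inl x) (Sum.inr j) ↔ x = f j := by
  simp [attachPendants, SimpleGraph.fromRel_adj]

lemma attachPendants_adj_inr_inr {i j : Fin r} :
    ¬ (attachPendants G f).Adj (Sum.inr i) (Sum.inr j) := by
  simp [attachPendants, SimpleGraph.fromRel_adj]

lemma reachable_attachPendants_deleteEdges_iff {a b : V} {w : V ⊕ Fin r} :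
    ((attachPendants G f).deleteEdges {s(Sum.inl a, Sum.inl b)}).Reachable (Sum.inl a) w ↔
      (G.deleteEdges {s(a, b)}).Reachable a (pendantRetract f w) := by
  constructor
  · intro h
    rw [SimpleGraph.reachable_iff_reflTransGen] at h
    induction h with
    | refl => exact SimpleGraph.Reachable.refl _
    | @tail x y _ hxy ih =>
      rw [SimpleGraph.deleteEdges_adj] at hxy
      obtain ⟨hadj, hne⟩ := hxy
      rcases x with x | i <;> rcases y with y | j
      · refine ih.trans (SimpleGraph.Adj.reachable ?_)
        rw [SimpleGraph.deleteEdges_adj]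
        refine ⟨attachPendants_adj_inl_inl.mp hadj, fun h => hne ?_⟩
        simpa [pendantRetract] using h
      · rwa [attachPendants_adj_inl_inr.mp hadj] at ih
      · rwa [attachPendants_adj_inl_inr.mp hadj.symm]
      · exact absurd hadj attachPendants_adj_inr_inr
  · intro h
    have lift : ∀ x, (G.deleteEdges {s(a, b)}).Reachable a x →
        ((attachPendants G f).deleteEdges {s(Sum.inl a, Sum.inl b)}).Reachable
          (Sum.inl a) (Sum.inl x) := fun x hx =>
      hx.map ⟨Sum.inl, fun {x y} hxy => by
        rw [SimpleGraph.deleteEdges_adj] at hxy ⊢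
        exact ⟨attachPendants_adj_inl_inl.mpr hxy.1, by simpa using hxy.2⟩⟩
    rcases w with x | j
    · exact lift x h
    · refine (lift (f j) h).trans (SimpleGraph.Adj.reachable ?_)
      rw [SimpleGraph.deleteEdges_adj]
      exact ⟨attachPendants_adj_inl_inr.mpr rfl, by simp⟩

lemma sideCard_attachPendants_inl_inl [Fintype V] (a b : V) :
    sideCard (attachPendants G f) (Sum.inl a) (Sum.inl b) =
      sideCard G a b + Nat.card {j : Fin r // (G.deleteEdges {s(a, b)}).Reachable a (f j)} := by
  unfold sideCard
  simp only [Set.coe_ofPred, reachable_attachPendants_deleteEdges_iff]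
  rw [Nat.card_congr (Equiv.subtypeSum), Nat.card_sum]
  rfl

lemma sideCard_attachPendants_inr_inl [Fintype V] (j : Fin r) :
    sideCard (attachPendants G f) (Sum.inr j) (Sum.inl (f j)) = 1 := by
  have : {w | ((attachPendants G f).deleteEdges {s(Sum.inr j, Sum.inl (f j))}).Reachable
      (Sum.inr j) w} = {Sum.inr j} := by
    ext w
    simp only [Set.mem_ofPred_eq, Set.mem_singleton_iff]
    refine ⟨fun h => ?_, fun h => h ▸ SimpleGraph.Reachable.refl _⟩
    rw [SimpleGraph.reachable_iff_reflTransGen] at h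
    induction h with
    | refl => rfl
    | @tail x y _ hxy ih =>
      subst ih
      rw [SimpleGraph.deleteEdges_adj] at hxy
      obtain ⟨hadj, hne⟩ := hxy
      rcases y with y | i
      · rw [attachPendants_adj_inl_inr.mp hadj.symm] at hne
        simp at hne
      · exact absurd hadj attachPendants_adj_inr_inr
  unfold sideCard
  rw [this]
  simp

lemma sideCard_attachPendants_inl_inr [Fintype V] (hG : G.Connected) (j : Fin r) :
    Fintype.card V + r ≤ sideCard (attachPendants G f) (Sum.inl (f j)) (Sum.inr j) + 1 := by
  set H := (attachPendants G f).deleteEdges {s(Sum.inl (f j), Sum.inr j)} with hH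
  have lift : ∀ x, H.Reachable (Sum.inl (f j)) (Sum.inl x) := fun x =>
    (hG.preconnected (f j) x).map ⟨Sum.inl, fun {x y} hxy => by
      rw [hH, SimpleGraph.deleteEdges_adj]
      exact ⟨attachPendants_adj_inl_inl.mpr hxy, by simp⟩⟩
  have hsub : {Sum.inr j}ᶜ ⊆ {w | H.Reachable (Sum.inl (f j)) w} := by
    rintro (x | i) hw
    · exact lift x
    · refine (lift (f i)).trans (SimpleGraph.Adj.reachable ?_)
      rw [hH, SimpleGraph.deleteEdges_adj]
      refine ⟨attachPendants_adj_inl_inr.mpr rfl, ?_⟩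
      have : i ≠ j := by simpa using hw
      simp [this]
  have hcard := Set.ncard_le_ncard hsub (Set.toFinite _)
  have hcompl := Set.ncard_add_ncard_compl ({Sum.inr j} : Set (V ⊕ Fin r))
  rw [Set.ncard_singleton, Nat.card_eq_fintype_card, Fintype.card_sum, Fintype.card_fin] at hcompl
  have : sideCard (attachPendants G f) (Sum.inl (f j)) (Sum.inr j) =
    {w | H.Reachable (Sum.inl (f j)) w}.ncard := rfl
  omega

end AttachPendants

section PathGraph

variable {n : ℕ} {a b : Fin n}

lemma pathGraph_adj_iff : (SimpleGraph.pathGraph n).Adj a b ↔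
    (a : ℕ) + 1 = b ∨ (b : ℕ) + 1 = a :=
  SimpleGraph.pathGraph_adj

lemma reachable_pathGraph_deleteEdges_left (hab : (a : ℕ) + 1 = b) (x : Fin n) :
    ((SimpleGraph.pathGraph n).deleteEdges {s(a, b)}).Reachable a x ↔ x ≤ a := by
  constructor
  · intro h
    rw [SimpleGraph.reachable_iff_reflTransGen] at h
    induction h with
    | refl => exact le_rfl
    | @tail x y _ hxy ih =>
      simp only [SimpleGraph.deleteEdges_adj, pathGraph_adj_iff, Set.mem_singleton_iff,
        Sym2.eq_iff, Fin.ext_iff, Fin.le_def] at *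
      omega
  · intro h
    obtain ⟨k, hk⟩ := Nat.exists_eq_add_of_le (Fin.le_def.mp h)
    induction k generalizing x with
    | zero =>
      obtain rfl : a = x := Fin.ext hk
      exact SimpleGraph.Reachable.refl _
    | succ k ih =>
      have hlt : (x : ℕ) + 1 < n := by omega
      refine (ih ⟨x + 1, hlt⟩ (Fin.le_def.mpr (by dsimp only; omega)) (by dsimp only; omega)).trans
        (SimpleGraph.Adj.reachable ?_)
      simp only [SimpleGraph.deleteEdges_adj, pathGraph_adj_iff, Set.mem_singleton_iff,
        Sym2.eq_iff, Fin.ext_iff, or_true, true_and]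
      omega

lemma reachable_pathGraph_deleteEdges_right (hab : (a : ℕ) + 1 = b) (x : Fin n) :
    ((SimpleGraph.pathGraph n).deleteEdges {s(b, a)}).Reachable b x ↔ b ≤ x := by
  constructor
  · intro h
    rw [SimpleGraph.reachable_iff_reflTransGen] at h
    induction h with
    | refl => exact le_rfl
    | @tail x y _ hxy ih =>
      simp only [SimpleGraph.deleteEdges_adj, pathGraph_adj_iff, Set.mem_singleton_iff,
        Sym2.eq_iff, Fin.ext_iff, Fin.le_def] at *
      omega
  · intro h
    obtain ⟨k, hk⟩ := Nat.exists_eq_add_of_le (Fin.le_def.mp h)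
    induction k generalizing x with
    | zero =>
      obtain rfl : x = b := Fin.ext hk
      exact SimpleGraph.Reachable.refl _
    | succ k ih =>
      have hlt : (x : ℕ) - 1 < n := by omega
      refine (ih ⟨x - 1, hlt⟩ (Fin.le_def.mpr (by dsimp only; omega)) (by dsimp only; omega)).trans
        (SimpleGraph.Adj.reachable ?_)
      simp only [SimpleGraph.deleteEdges_adj, pathGraph_adj_iff, Set.mem_singleton_iff,
        Sym2.eq_iff, Fin.ext_iff]
      omega

lemma sideCard_pathGraph_left (hab : (a : ℕ) + 1 = b) :
    sideCard (SimpleGraph.pathGraph n) a b = a + 1 := by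
  unfold sideCard
  simp only [Set.coe_ofPred, reachable_pathGraph_deleteEdges_left hab]
  exact (Nat.card_eq_fintype_card (α := Set.Iic a)).trans (by simp)

lemma sideCard_pathGraph_right (hab : (a : ℕ) + 1 = b) :
    sideCard (SimpleGraph.pathGraph n) b a = n - b := by
  unfold sideCard
  simp only [Set.coe_ofPred, reachable_pathGraph_deleteEdges_right hab]
  exact (Nat.card_eq_fintype_card (α := Set.Ici b)).trans (by simp)

variable {r : ℕ} (f : Fin r → Fin n)

lemma sideCard_attachPendants_pathGraph_left (hab : (a : ℕ) + 1 = b) :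
    sideCard (attachPendants (SimpleGraph.pathGraph n) f) (Sum.inl a) (Sum.inl b) =
      a + 1 + #{j | f j ≤ a} := by
  rw [sideCard_attachPendants_inl_inl, sideCard_pathGraph_left hab]
  simp only [reachable_pathGraph_deleteEdges_left hab]
  rw [Nat.card_eq_fintype_card, Fintype.card_subtype]

lemma sideCard_attachPendants_pathGraph_right (hab : (a : ℕ) + 1 = b) :
    sideCard (attachPendants (SimpleGraph.pathGraph n) f) (Sum.inl b) (Sum.inl a) =
      n - b + (r - #{j | f j ≤ a}) := by
  rw [sideCard_attachPendants_inl_inl, sideCard_pathGraph_right hab]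
  simp only [reachable_pathGraph_deleteEdges_right hab]
  rw [Nat.card_eq_fintype_card, Fintype.card_subtype]
  have h := card_filter_add_card_filter_not (s := (univ : Finset (Fin r))) (fun j => f j ≤ a)
  have hnot : ∀ j, ¬ f j ≤ a ↔ b ≤ f j := fun j => by
    rw [Fin.le_def, Fin.le_def]
    omega
  simp only [hnot, card_univ, Fintype.card_fin] at h
  omega

end PathGraph

lemma IsCentreEdge.symm {V : Type*} [Fintype V] {T : SimpleGraph V} {u v : V}
    (h : IsCentreEdge T u v) : IsCentreEdge T v u :=
  ⟨h.1.symm, fun a b hab => by rw [abs_sub_comm]; exact h.2 a b hab⟩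

/-- A centre edge of a path splits it into two parts whose sizes differ by at most one. -/
lemma IsCentreEdge.pathGraph_bound {n : ℕ} (hn : 2 ≤ n) {u v : Fin n}
    (huv : (u : ℕ) + 1 = v) (h : IsCentreEdge (SimpleGraph.pathGraph n) u v) :
    |2 * ((u : ℤ) + 1) - n| ≤ 1 := by
  have hmid : (n / 2 - 1) + 1 = n / 2 := by omega
  have key := h.2 ⟨n / 2 - 1, by omega⟩ ⟨n / 2, by omega⟩ (pathGraph_adj_iff.mpr (Or.inl hmid))
  rw [sideCard_pathGraph_left huv, sideCard_pathGraph_right huv, sideCard_pathGraph_left hmid,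
    sideCard_pathGraph_right hmid] at key
  have := v.isLt
  simp only [abs_eq_max_neg] at key ⊢
  omega

lemma IsCentreEdge.attachPendants_of_lt {n r : ℕ} (hn : 2 ≤ n) {u v : Fin n}
    (hlt : (u : ℕ) + 1 = v) (huv : IsCentreEdge (SimpleGraph.pathGraph n) u v)
    (f : Fin r → Fin n) (hf : ∀ j, f j = u ∨ f j = v) :
    IsCentreEdge (attachPendants (SimpleGraph.pathGraph n) f) (Sum.inl u) (Sum.inl v) := by
  have hbound := huv.pathGraph_bound hn hlt
  have hv := v.isLt
  have hle : ∀ c : Fin n, #{j | f j ≤ c} ≤ r := fun c => (card_filter_le _ _).trans (by simp)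
  have hu := hle u
  have path : ∀ a b : Fin n, (a : ℕ) + 1 = b →
      |(sideCard (attachPendants (SimpleGraph.pathGraph n) f) (Sum.inl u) (Sum.inl v) : ℤ) -
        sideCard (attachPendants (SimpleGraph.pathGraph n) f) (Sum.inl v) (Sum.inl u)| ≤
      |(sideCard (attachPendants (SimpleGraph.pathGraph n) f) (Sum.inl a) (Sum.inl b) : ℤ) -
        sideCard (attachPendants (SimpleGraph.pathGraph n) f) (Sum.inl b) (Sum.inl a)| := by
    intro a b hab
    have hb := b.isLt
    rcases lt_trichotomy a u with h | rfl | h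
    · have hcard : #{j | f j ≤ a} = 0 := by
        rw [card_eq_zero, filter_eq_empty_iff]
        intro j _
        rw [Fin.lt_def] at h
        rcases hf j with e | e <;> rw [e, Fin.le_def] <;> omega
      rw [Fin.lt_def] at h
      rw [sideCard_attachPendants_pathGraph_left f hlt, sideCard_attachPendants_pathGraph_right f hlt,
        sideCard_attachPendants_pathGraph_left f hab, sideCard_attachPendants_pathGraph_right f hab,
        hcard]
      simp only [abs_eq_max_neg] at hbound ⊢
      omega
    · obtain rfl : b = v := Fin.ext (by omega)
      exact le_rfl
    · have hcard : #{j | f j ≤ a} = r := by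
        rw [filter_true_of_mem, card_univ, Fintype.card_fin]
        intro j _
        rw [Fin.lt_def] at h
        rcases hf j with e | e <;> rw [e, Fin.le_def] <;> omega
      rw [Fin.lt_def] at h
      rw [sideCard_attachPendants_pathGraph_left f hlt, sideCard_attachPendants_pathGraph_right f hlt,
        sideCard_attachPendants_pathGraph_left f hab, sideCard_attachPendants_pathGraph_right f hab,
        hcard]
      simp only [abs_eq_max_neg] at hbound ⊢
      omega
  have pendant : ∀ j : Fin r,
      |(sideCard (attachPendants (SimpleGraph.pathGraph n) f) (Sum.inl u) (Sum.inl v) : ℤ) -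
        sideCard (attachPendants (SimpleGraph.pathGraph n) f) (Sum.inl v) (Sum.inl u)| ≤
      |(sideCard (attachPendants (SimpleGraph.pathGraph n) f) (Sum.inl (f j)) (Sum.inr j) : ℤ) -
        sideCard (attachPendants (SimpleGraph.pathGraph n) f) (Sum.inr j) (Sum.inl (f j))| := by
    intro j
    have hconn : (SimpleGraph.pathGraph n).Connected := by
      obtain ⟨m, rfl⟩ : ∃ m, n = m + 1 := ⟨n - 1, by omega⟩
      exact SimpleGraph.pathGraph_connected m
    have hge := sideCard_attachPendants_inl_inr (f := f) hconn j
    rw [Fintype.card_fin] at hge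
    rw [sideCard_attachPendants_inr_inl, sideCard_attachPendants_pathGraph_left f hlt,
      sideCard_attachPendants_pathGraph_right f hlt]
    simp only [abs_eq_max_neg] at hbound ⊢
    omega
  refine ⟨attachPendants_adj_inl_inl.mpr huv.1, ?_⟩
  rintro (a | i) (b | j) hab
  · rcases pathGraph_adj_iff.mp (attachPendants_adj_inl_inl.mp hab) with h | h
    · exact path a b h
    · rw [abs_sub_comm (sideCard _ (Sum.inl a) (Sum.inl b) : ℤ)]
      exact path b a h
  · obtain rfl := attachPendants_adj_inl_inr.mp hab
    exact pendant j
  · obtain rfl := attachPendants_adj_inl_inr.mp hab.symm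
    rw [abs_sub_comm (sideCard _ (Sum.inr i) _ : ℤ)]
    exact pendant i
  · exact absurd hab attachPendants_adj_inr_inr

/-- Let `uv` be a centre edge of the path graph `P_n` (`n ≥ 2`) and let
`T'` be the tree obtained from `P_n` by attaching `r` new pendant vertices, each adjacent
to `u` or to `v`.  Then `uv` is a centre edge of `T'`. -/
theorem stmt7 {n r : ℕ} (hn : 2 ≤ n) (u v : Fin n)
    (huv : IsCentreEdge (SimpleGraph.pathGraph n) u v)
    (f : Fin r → Fin n) (hf : ∀ j, f j = u ∨ f j = v) :
    IsCentreEdge (attachPendants (SimpleGraph.pathGraph n) f) (Sum.inl u) (Sum.inl v) := by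
  rcases pathGraph_adj_iff.mp huv.1 with h | h
  · exact huv.attachPendants_of_lt hn h f hf
  · exact (huv.symm.attachPendants_of_lt hn h f fun j => (hf j).symm).symm
end

section
/- Let T be a tree on n vertices with diameter D ≥ 3. Then n/(2·⌈n/2⌉·⌊n/2⌋) ≤ b(T) ≤ n/(2·⌈D/2⌉·(n − ⌈D/2⌉)). -/
open Finset

/-- Summing a function of edges over ordered pairs of adjacent vertices counts each edge twice. -/
theorem SimpleGraph.sum_adj_eq_two_mul_sum_edgeFinset {V : Type*} [Fintype V] [DecidableEq V]
    (G : SimpleGraph V) [DecidableRel G.Adj] (f : Sym2 V → ℝ) :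
    (∑ u, ∑ v, if G.Adj u v then f s(u, v) else 0) = 2 * ∑ e ∈ G.edgeFinset, f e := by
  have h1 : (∑ u, ∑ v, if G.Adj u v then f s(u, v) else 0) = ∑ d : G.Dart, f d.edge := by
    rw [← Finset.sum_product', Finset.univ_product_univ, ← Finset.sum_filter]
    symm
    refine Finset.sum_bij (fun d _ => d.toProd) (fun d _ => by simp)
      (fun d _ d' _ h => SimpleGraph.Dart.ext _ _ h) (fun p hp => ?_) (fun d _ => rfl)
    exact ⟨⟨p, by simpa using hp⟩, Finset.mem_univ _, rfl⟩
  rw [h1, ← Finset.sum_fiberwise_of_maps_to (s := Finset.univ) (t := G.edgeFinset)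
    (g := fun d : G.Dart => d.edge) (fun d _ => by simp), Finset.mul_sum]
  refine Finset.sum_congr rfl fun e he => ?_
  rw [Finset.sum_congr rfl (g := fun _ => f e) (fun d hd => by rw [(Finset.mem_filter.1 hd).2]),
    Finset.sum_const, G.dart_edge_fiber_card e (by simpa using he)]
  simp

theorem SimpleGraph.Walk.abs_sub_le_sum_edges {V : Type*} {G : SimpleGraph V} (x : V → ℝ)
    (f : Sym2 V → ℝ) (hf : ∀ u v, f s(u, v) = |x u - x v|) {a b : V} (p : G.Walk a b) :
    |x a - x b| ≤ (p.edges.map f).sum := by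
  induction p with
  | nil => simp
  | cons h p ih =>
    simp only [SimpleGraph.Walk.edges_cons, List.map_cons, List.sum_cons, hf]
    exact (abs_sub_le _ _ _).trans (by gcongr)

open Classical in
theorem SimpleGraph.Connected.abs_sub_le_variation {V : Type*} [Fintype V] {G : SimpleGraph V}
    (hG : G.Connected) (x : V → ℝ) (a b : V) :
    |x a - x b| ≤ (1 / 2) * ∑ u, ∑ v, if G.Adj u v then |x u - x v| else 0 := by
  let f : Sym2 V → ℝ := Sym2.lift ⟨fun u v => |x u - x v|, fun u v => abs_sub_comm _ _⟩
  have hf : ∀ u v, f s(u, v) = |x u - x v| := fun u v => rfl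
  have hf0 : ∀ e, 0 ≤ f e := fun e => e.ind fun u v => by rw [hf]; positivity
  obtain ⟨p, hp⟩ := hG.exists_isPath a b
  have key := G.sum_adj_eq_two_mul_sum_edgeFinset f
  simp only [hf] at key
  rw [key]
  calc |x a - x b| ≤ (p.edges.map f).sum := p.abs_sub_le_sum_edges x f hf
    _ = ∑ e ∈ p.edges.toFinset, f e := (List.sum_toFinset f hp.isTrail.edges_nodup).symm
    _ ≤ ∑ e ∈ G.edgeFinset, f e := by
        refine Finset.sum_le_sum_of_subset_of_nonneg (fun e he => ?_) fun e _ _ => hf0 e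
        simpa using p.edges_subset_edgeSet (by simpa using he)
    _ = _ := by ring

theorem Nat.mul_le_half_mul_half (p q : ℕ) : p * q ≤ (p + q + 1) / 2 * ((p + q) / 2) := by
  obtain ⟨m, hm | hm⟩ := Nat.even_or_odd' (p + q)
  · rw [hm, show (2 * m + 1) / 2 = m by omega, show 2 * m / 2 = m by omega]
    zify at hm ⊢
    nlinarith [sq_nonneg ((p : ℤ) - q)]
  · rw [hm, show (2 * m + 1 + 1) / 2 = m + 1 by omega, show (2 * m + 1) / 2 = m by omega]
    obtain h | h := le_or_gt p m
    · obtain ⟨d, rfl⟩ := Nat.exists_eq_add_of_le h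
      obtain rfl : q = p + 2 * d + 1 := by omega
      nlinarith
    · obtain ⟨d, rfl⟩ := Nat.exists_eq_add_of_lt h
      obtain rfl : m = q + d := by omega
      nlinarith

/-- A mean-zero function of unit `ℓ1` norm on `n` points oscillates by at least
`n / (2 ⌈n/2⌉ ⌊n/2⌋)`. -/
theorem exists_le_sub_of_sum_eq_zero {V : Type*} [Fintype V] (x : V → ℝ)
    (h0 : ∑ v, x v = 0) (h1 : ∑ v, |x v| = 1) :
    ∃ a b, (Fintype.card V : ℝ) /
        (2 * (((Fintype.card V + 1) / 2 : ℕ) : ℝ) * ((Fintype.card V / 2 : ℕ) : ℝ)) ≤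
      x a - x b := by
  classical
  have hne : (Finset.univ : Finset V).Nonempty := by
    by_contra h
    simp [Finset.not_nonempty_iff_eq_empty.1 h] at h1
  obtain ⟨a, -, ha⟩ := Finset.exists_max_image Finset.univ x hne
  obtain ⟨b, -, hb⟩ := Finset.exists_min_image Finset.univ x hne
  refine ⟨a, b, ?_⟩
  set P := Finset.univ.filter fun v => 0 < x v
  set Q := Finset.univ.filter fun v => ¬ 0 < x v
  have hs : ∑ v ∈ P, x v + ∑ v ∈ Q, x v = 0 := by
    rw [← h0]; exact Finset.sum_filter_add_sum_filter_not _ _ _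
  have hs' : ∑ v ∈ P, x v - ∑ v ∈ Q, x v = 1 := by
    rw [← h1, ← Finset.sum_filter_add_sum_filter_not Finset.univ (fun v => 0 < x v),
      sub_eq_add_neg, ← Finset.sum_neg_distrib]
    congr 1
    · exact Finset.sum_congr rfl fun v hv => (abs_of_pos (Finset.mem_filter.1 hv).2).symm
    · exact Finset.sum_congr rfl fun v hv =>
        (abs_of_nonpos (not_lt.1 (Finset.mem_filter.1 hv).2)).symm
  have hc : #P + #Q = Fintype.card V := Finset.card_filter_add_card_filter_not _
  have hP : ∑ v ∈ P, x v ≤ #P * x a := by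
    simpa using Finset.sum_le_card_nsmul P x (x a) fun v _ => ha v (Finset.mem_univ v)
  have hQ : #Q * x b ≤ ∑ v ∈ Q, x v := by
    simpa using Finset.card_nsmul_le_sum Q x (x b) fun v _ => hb v (Finset.mem_univ v)
  have hP0 : 0 < (#P : ℝ) := by
    rcases (#P).eq_zero_or_pos with h | h
    · rw [h] at hP; norm_num at hP; linarith
    · exact_mod_cast h
  have hQ0 : 0 < (#Q : ℝ) := by
    rcases (#Q).eq_zero_or_pos with h | h
    · rw [h] at hQ; norm_num at hQ; linarith
    · exact_mod_cast h
  have hm : (#P : ℝ) * #Q ≤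
      (((Fintype.card V + 1) / 2 : ℕ) : ℝ) * ((Fintype.card V / 2 : ℕ) : ℝ) := by
    rw [← hc]; exact_mod_cast Nat.mul_le_half_mul_half _ _
  calc _ ≤ (Fintype.card V : ℝ) / (2 * (#P * #Q)) := by
        rw [mul_assoc]; gcongr
    _ = 1 / 2 / #P + 1 / 2 / #Q := by
        rw [← hc]; push_cast; field_simp; ring
    _ ≤ x a + -x b := by
        gcongr
        · rw [div_le_iff₀ hP0]; linarith
        · rw [div_le_iff₀ hQ0]; linarith
    _ = x a - x b := by ring

open Classical in
/-- A cut crossed by the single edge `ab` gives a feasible vector for `l1Fiedler`. -/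
theorem exists_feasible_of_cut {V : Type*} [Fintype V] (G : SimpleGraph V) (S : Finset V)
    {a b : V} (ha : a ∈ S) (hb : b ∉ S) (hab : G.Adj a b)
    (hcut : ∀ u ∈ S, ∀ v ∉ S, G.Adj u v → u = a ∧ v = b) :
    ∃ x : V → ℝ, (∑ v, x v) = 0 ∧ (∑ v, |x v|) = 1 ∧
      (Fintype.card V : ℝ) / (2 * #S * (Fintype.card V - #S)) =
        (1 / 2) * ∑ u, ∑ v, if G.Adj u v then |x u - x v| else 0 := by
  set n : ℝ := (Fintype.card V : ℝ)
  set s : ℝ := (#S : ℝ)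
  have hs : 0 < s := Nat.cast_pos.2 (Finset.card_pos.2 ⟨a, ha⟩)
  have hc : (#Sᶜ : ℝ) = n - s := by
    rw [Finset.card_compl, Nat.cast_sub (Finset.card_le_univ S)]
  have ht : 0 < n - s := by
    rw [← hc]; exact_mod_cast Finset.card_pos.2 ⟨b, by simpa using hb⟩
  have hn : 0 < n := by linarith
  have hsum : ∀ p q : ℝ, ∑ v, (if v ∈ S then p else q) = s * p + (n - s) * q := by
    intro p q
    rw [Finset.sum_ite, Finset.sum_const, Finset.sum_const, nsmul_eq_mul, nsmul_eq_mul,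
      ← hc, Finset.filter_mem_eq_inter, Finset.univ_inter, Finset.compl_eq_univ_sdiff,
      Finset.filter_notMem_eq_sdiff]
  have hd : 1 / (2 * s) + 1 / (2 * (n - s)) = n / (2 * s * (n - s)) := by
    field_simp; ring
  refine ⟨fun v => if v ∈ S then 1 / (2 * s) else -(1 / (2 * (n - s))), ?_, ?_, ?_⟩
  · rw [hsum]; field_simp; ring
  · simp only [apply_ite abs, abs_neg]
    rw [hsum, abs_of_pos (by positivity), abs_of_pos (by positivity)]
    field_simp; norm_num
  · have hterm : ∀ u v, (if G.Adj u v then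
        |(if u ∈ S then 1 / (2 * s) else -(1 / (2 * (n - s)))) -
          (if v ∈ S then 1 / (2 * s) else -(1 / (2 * (n - s))))| else 0) =
        (if u = a then if v = b then n / (2 * s * (n - s)) else 0 else 0) +
        (if u = b then if v = a then n / (2 * s * (n - s)) else 0 else 0) := by
      have hpos : 0 < n / (2 * s * (n - s)) := by positivity
      have hne : a ≠ b := hab.ne
      intro u v
      by_cases hu : u ∈ S <;> by_cases hv : v ∈ S
      · have : u ≠ b := fun h => hb (h ▸ hu)
        have : v ≠ b := fun h => hb (h ▸ hv)
        simp [*]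
      · have hub : u ≠ b := fun h => hb (h ▸ hu)
        have : G.Adj u v ↔ u = a ∧ v = b :=
          ⟨hcut u hu v hv, fun h => by rw [h.1, h.2]; exact hab⟩
        simp only [this, hu, hv, hub, if_true, if_false, sub_neg_eq_add, hd, abs_of_pos hpos,
          add_zero, ite_and]
      · have hua : u ≠ a := fun h => hu (h ▸ ha)
        have : G.Adj u v ↔ u = b ∧ v = a :=
          ⟨fun h => (hcut v hv u hu h.symm).symm, fun h => by rw [h.1, h.2]; exact hab.symm⟩
        rw [abs_sub_comm]
        simp only [this, hu, hv, hua, if_true, if_false, sub_neg_eq_add, hd, abs_of_pos hpos,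
          zero_add, ite_and]
      · have : u ≠ a := fun h => hu (h ▸ ha)
        have : v ≠ a := fun h => hv (h ▸ ha)
        simp [*]
    simp only [hterm, Finset.sum_add_distrib]
    simp
    ring

/-- The middle edge of a diametral path of a tree splits it into two parts, each with at least
`⌈D/2⌉` vertices. -/
theorem SimpleGraph.IsTree.exists_cut {V : Type*} [Fintype V] {T : SimpleGraph V}
    (hT : T.IsTree) (hD : 1 ≤ T.diam) :
    ∃ (S : Finset V) (a b : V), a ∈ S ∧ b ∉ S ∧ T.Adj a b ∧
      (∀ u ∈ S, ∀ v ∉ S, T.Adj u v → u = a ∧ v = b) ∧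
      (T.diam + 1) / 2 ≤ #S ∧ #S + (T.diam + 1) / 2 ≤ Fintype.card V := by
  classical
  have := hT.connected.nonempty
  obtain ⟨u, v, huv⟩ := T.exists_dist_eq_diam
  obtain ⟨p, hp⟩ := hT.connected.exists_walk_length_eq_dist u v
  have hpath := p.isPath_of_length_eq_dist hp
  rw [huv] at hp
  obtain ⟨k, hk⟩ : ∃ k, (T.diam + 1) / 2 = k + 1 := ⟨(T.diam + 1) / 2 - 1, by omega⟩
  set g := p.getVert
  have hinj : ∀ i j, i ≤ T.diam → j ≤ T.diam → g i = g j → i = j := fun i j hi hj h =>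
    hpath.getVert_injOn (by simpa [hp] using hi) (by simpa [hp] using hj) h
  have hadj : ∀ i, i < T.diam → T.Adj (g i) (g (i + 1)) := fun i hi =>
    p.adj_getVert_succ (by omega)
  set H := T.deleteEdges {s(g k, g (k + 1))}
  have hHadj : ∀ i, i < T.diam → i ≠ k → H.Adj (g i) (g (i + 1)) := by
    intro i hi hik
    refine SimpleGraph.deleteEdges_adj.2 ⟨hadj i hi, ?_⟩
    rw [Set.mem_singleton_iff, Sym2.eq_iff]
    rintro (⟨h, -⟩ | ⟨h, h'⟩)
    · exact hik (hinj _ _ (by omega) (by omega) h)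
    · have := hinj _ _ (by omega) (by omega) h
      have := hinj _ _ (by omega) (by omega) h'
      omega
  have hbridge : ¬ H.Reachable (g k) (g (k + 1)) :=
    SimpleGraph.isBridge_iff.1
      (SimpleGraph.isAcyclic_iff_forall_adj_isBridge.1 hT.isAcyclic (hadj k (by omega)))
  have hleft : ∀ j ≤ k, H.Reachable (g k) (g (k - j)) := by
    intro j
    induction j with
    | zero => intro _; exact SimpleGraph.Reachable.refl _
    | succ j ih =>
      intro hj
      have := hHadj (k - (j + 1)) (by omega) (by omega)
      rw [show k - (j + 1) + 1 = k - j by omega] at this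
      exact (ih (by omega)).trans this.symm.reachable
  have hright : ∀ j, k + 1 + j ≤ T.diam → H.Reachable (g (k + 1)) (g (k + 1 + j)) := by
    intro j
    induction j with
    | zero => intro _; exact SimpleGraph.Reachable.refl _
    | succ j ih =>
      intro hj
      exact (ih (by omega)).trans (hHadj (k + 1 + j) (by omega) (by omega)).reachable
  set S : Finset V := Finset.univ.filter fun w => H.Reachable (g k) w
  have hmem : ∀ w, w ∈ S ↔ H.Reachable (g k) w := fun w => by simp [S]
  refine ⟨S, g k, g (k + 1), (hmem _).2 (SimpleGraph.Reachable.refl _),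
    fun h => hbridge ((hmem _).1 h), hadj k (by omega), ?_, ?_, ?_⟩
  · intro w hw z hz hwz
    rw [hmem] at hw hz
    by_cases h : s(w, z) = s(g k, g (k + 1))
    · rcases Sym2.eq_iff.1 h with h | ⟨h, -⟩
      · exact h
      · exact absurd (h ▸ hw) hbridge
    · exact absurd (hw.trans (SimpleGraph.Adj.reachable
        (SimpleGraph.deleteEdges_adj.2 ⟨hwz, h⟩))) hz
  · rw [hk, ← Finset.card_range (k + 1)]
    refine Finset.card_le_card_of_injOn g (fun i hi => ?_) fun i hi j hj h => ?_
    · have hi : i < k + 1 := by simpa using hi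
      have := hleft (k - i) (by omega)
      rw [show k - (k - i) = i by omega] at this
      exact (hmem _).2 this
    · have hi : i < k + 1 := by simpa using hi
      have hj : j < k + 1 := by simpa using hj
      exact hinj i j (by omega) (by omega) h
  · rw [← Finset.card_add_card_compl S, hk]
    gcongr
    rw [← Finset.card_range (k + 1)]
    refine Finset.card_le_card_of_injOn (fun i => g (k + 1 + i)) (fun i hi => ?_)
      fun i hi j hj h => ?_
    · have hi : i < k + 1 := by simpa using hi
      have := hright i (by omega)
      have hn : g (k + 1 + i) ∉ S := fun h => hbridge (((hmem _).1 h).trans this.symm)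
      simpa using hn
    · have hi : i < k + 1 := by simpa using hi
      have hj : j < k + 1 := by simpa using hj
      have := hinj (k + 1 + i) (k + 1 + j) (by omega) (by omega) h
      omega

/-- For a tree `T` on `n` vertices with diameter `D ≥ 3`,
`n / (2 ⌈n/2⌉ ⌊n/2⌋) ≤ b(T) ≤ n / (2 ⌈D/2⌉ (n - ⌈D/2⌉))`. -/
theorem stmt9 {V : Type*} [Fintype V] (T : SimpleGraph V) (hT : T.IsTree)
    (hD : 3 ≤ T.diam) :
    (Fintype.card V : ℝ) /
        (2 * (((Fintype.card V + 1) / 2 : ℕ) : ℝ) * ((Fintype.card V / 2 : ℕ) : ℝ)) ≤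
      l1Fiedler T ∧
    l1Fiedler T ≤ (Fintype.card V : ℝ) /
      (2 * (((T.diam + 1) / 2 : ℕ) : ℝ) *
        ((Fintype.card V : ℝ) - (((T.diam + 1) / 2 : ℕ) : ℝ))) := by
  obtain ⟨S, a, b, ha, hb, hab, hcut, hS, hS'⟩ := hT.exists_cut (by omega)
  obtain ⟨x, hx0, hx1, hx⟩ := exists_feasible_of_cut T S ha hb hab hcut
  constructor
  · refine le_csInf ⟨_, x, hx0, hx1, hx⟩ ?_
    rintro y ⟨z, hz0, hz1, rfl⟩
    obtain ⟨c, d, hcd⟩ := exists_le_sub_of_sum_eq_zero z hz0 hz1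
    exact hcd.trans ((le_abs_self _).trans (hT.connected.abs_sub_le_variation z c d))
  · refine le_trans (b := (Fintype.card V : ℝ) / (2 * #S * (Fintype.card V - #S)))
      (csInf_le ⟨0, ?_⟩ ⟨x, hx0, hx1, hx⟩) ?_
    · rintro y ⟨z, -, -, rfl⟩
      positivity
    · have hk : (1 : ℝ) ≤ (((T.diam + 1) / 2 : ℕ) : ℝ) := by
        exact_mod_cast (by omega : 1 ≤ (T.diam + 1) / 2)
      have h1 : (((T.diam + 1) / 2 : ℕ) : ℝ) ≤ #S := by exact_mod_cast hS
      have h2 : (#S : ℝ) + (((T.diam + 1) / 2 : ℕ) : ℝ) ≤ Fintype.card V := by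
        exact_mod_cast hS'
      apply div_le_div_of_nonneg_left (by positivity)
      · exact mul_pos (by linarith) (by linarith)
      · nlinarith
end

section
/- Let G be a connected finite simple graph on n ≥ 2 vertices with edge-connectivity k. Then b(G) ≤ n·k/(2(n−1)). -/
open Finset

/-- The edge-connectivity of `G`: the minimum number of edges whose removal
disconnects `G`. -/
noncomputable def edgeConn {V : Type*} [Fintype V] (G : SimpleGraph V) : ℕ :=
  sInf { k : ℕ | ∃ F : Finset (Sym2 V), ↑F ⊆ G.edgeSet ∧ F.card = k ∧
    ¬ (G.deleteEdges ↑F).Connected }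

/-- If no edge of `G` outside `F` leaves the proper nonempty vertex set `S`, then the vector which
is constant on `S` and on its complement shows `b(G) ≤ n |F| / (2 |S| (n - |S|))`. -/
theorem l1Fiedler_le_of_cut_s15 {V : Type*} [Fintype V] [DecidableEq V] (G : SimpleGraph V)
    (F : Finset (Sym2 V)) (S : Finset V) (hS : S.Nonempty) (hSc : Sᶜ.Nonempty)
    (hF : ∀ u ∈ S, ∀ v ∉ S, G.Adj u v → s(u, v) ∈ F) :
    l1Fiedler G ≤ (Fintype.card V : ℝ) * (#F : ℝ) / (2 * ((#S : ℝ) * (#Sᶜ : ℝ))) := by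
  classical
  have hs : (0 : ℝ) < #S := by exact_mod_cast hS.card_pos
  have ht : (0 : ℝ) < #Sᶜ := by exact_mod_cast hSc.card_pos
  have hst : (Fintype.card V : ℝ) = #S + #Sᶜ := by
    exact_mod_cast (Finset.card_add_card_compl S).symm
  set s : ℝ := (#S : ℝ)
  set t : ℝ := (#Sᶜ : ℝ)
  let x : V → ℝ := fun v => if v ∈ S then 1 / (2 * s) else -(1 / (2 * t))
  have sum_split (f : V → ℝ) (p q : ℝ) (hp : ∀ v ∈ S, f v = p) (hq : ∀ v ∈ Sᶜ, f v = q) :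
      ∑ v, f v = s * p + t * q := by
    rw [← Finset.sum_add_sum_compl S f, Finset.sum_congr rfl hp, Finset.sum_congr rfl hq]
    simp [s, t]
  have hx_in : ∀ v ∈ S, x v = 1 / (2 * s) := fun v hv => by simp only [x, if_pos hv]
  have hx_out : ∀ v ∉ S, x v = -(1 / (2 * t)) := fun v hv => by simp only [x, if_neg hv]
  have hx_sum : ∑ v, x v = 0 := by
    rw [sum_split x _ _ hx_in fun v hv => hx_out v (by simpa using hv)]
    field_simp
    norm_num
  have hx_abs : ∑ v, |x v| = 1 := by
    rw [sum_split (fun v => |x v|) (1 / (2 * s)) (1 / (2 * t))]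
    · field_simp
      norm_num
    · intro v hv
      simp only [hx_in v hv]
      exact abs_of_pos (by positivity)
    · intro v hv
      simp only [hx_out v (by simpa using hv), abs_neg]
      exact abs_of_pos (by positivity)
  set c : ℝ := 1 / (2 * s) + 1 / (2 * t) with hc
  have hc0 : 0 < c := by positivity
  let χ : V → V → ℝ := fun u v => if u ∈ S ∧ v ∉ S ∧ G.Adj u v then 1 else 0
  have hterm (u v : V) : (if G.Adj u v then |x u - x v| else 0) = c * (χ u v + χ v u) := by
    by_cases h : G.Adj u v
    · have h' := h.symm
      by_cases hu : u ∈ S <;> by_cases hv : v ∈ S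
      · simp [χ, h, hu, hv, hx_in]
      · simp only [χ, h, h', hu, hv, hx_in u hu, hx_out v hv]
        rw [sub_neg_eq_add, ← hc]
        simp [abs_of_pos hc0]
      · simp only [χ, h, h', hu, hv, hx_in v hv, hx_out u hu]
        rw [abs_sub_comm, sub_neg_eq_add, ← hc]
        simp [abs_of_pos hc0]
      · simp [χ, h, hu, hv, hx_out]
    · have h' : ¬ G.Adj v u := fun h' => h h'.symm
      simp [χ, h, h']
  have hχ : ∑ u, ∑ v, χ u v ≤ #F := by
    have h_card : ∑ u, ∑ v, χ u v =
        #{p : V × V | p.1 ∈ S ∧ p.2 ∉ S ∧ G.Adj p.1 p.2} := by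
      rw [← Fintype.sum_prod_type' χ]
      simp [χ]
    rw [h_card]
    norm_cast
    refine Finset.card_le_card_of_injOn (fun p => s(p.1, p.2)) ?_ ?_
    · intro p hp
      simp only [Finset.coe_filter, Finset.mem_univ, true_and, Set.mem_ofPred_eq] at hp
      exact hF _ hp.1 _ hp.2.1 hp.2.2
    · rintro ⟨u, v⟩ hp ⟨u', v'⟩ hq h
      simp only [Finset.coe_filter, Finset.mem_univ, true_and, Set.mem_ofPred_eq] at hp hq
      rcases Sym2.eq_iff.1 h with ⟨h₁, h₂⟩ | ⟨h₁, h₂⟩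
      · rw [Prod.mk.injEq]
        exact ⟨h₁, h₂⟩
      · obtain rfl : u = v' := h₁
        exact absurd hp.1 hq.2.1
  have h_energy : (1 / 2) * ∑ u, ∑ v, (if G.Adj u v then |x u - x v| else 0) =
      c * ∑ u, ∑ v, χ u v := by
    simp only [hterm, ← Finset.mul_sum, Finset.sum_add_distrib]
    rw [Finset.sum_comm (f := fun u v => χ v u)]
    ring
  have h_bdd : l1Fiedler G ≤ c * ∑ u, ∑ v, χ u v := by
    refine csInf_le ⟨0, ?_⟩ ⟨x, hx_sum, hx_abs, h_energy.symm.trans (by congr!)⟩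
    rintro y ⟨z, -, -, rfl⟩
    refine mul_nonneg (by norm_num) (Finset.sum_nonneg fun u _ => Finset.sum_nonneg fun v _ => ?_)
    split_ifs <;> positivity
  calc l1Fiedler G ≤ c * #F := h_bdd.trans (by gcongr)
    _ = _ := by
      rw [hst, hc]
      field_simp
      ring

/-- A graph with at least two vertices has a set of `edgeConn G` edges that disconnects it. -/
theorem exists_card_eq_edgeConn {V : Type*} [Fintype V] (G : SimpleGraph V)
    (hn : 2 ≤ Fintype.card V) :
    ∃ F : Finset (Sym2 V), ↑F ⊆ G.edgeSet ∧ #F = edgeConn G ∧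
      ¬ (G.deleteEdges ↑F).Connected := by
  classical
  refine Nat.sInf_mem (s := { k : ℕ | ∃ F : Finset (Sym2 V), ↑F ⊆ G.edgeSet ∧ F.card = k ∧
    ¬ (G.deleteEdges ↑F).Connected }) ⟨_, G.edgeFinset, by simp, rfl, ?_⟩
  obtain ⟨a, b, hab⟩ := Fintype.exists_pair_of_one_lt_card hn
  intro h
  have h_reach := h.preconnected a b
  simp [hab] at h_reach

/-- Let `G` be a connected graph on `n ≥ 2` vertices with
edge-connectivity `k`.  Then `b(G) ≤ n k / (2(n - 1))`. -/
theorem stmt15 {V : Type*} [Fintype V] (G : SimpleGraph V) (hG : G.Connected)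
    (hn : 2 ≤ Fintype.card V) :
    l1Fiedler G ≤ (Fintype.card V : ℝ) * (edgeConn G : ℝ) /
      (2 * ((Fintype.card V : ℝ) - 1)) := by
  classical
  obtain ⟨F, -, hF_card, hF⟩ := exists_card_eq_edgeConn G hn
  have hne := hG.nonempty
  obtain ⟨a, b, hab⟩ : ∃ a b, ¬ (G.deleteEdges ↑F).Reachable a b := by
    by_contra! h
    exact hF ⟨h⟩
  let S : Finset V := {v | (G.deleteEdges ↑F).Reachable a v}
  have hS : S.Nonempty := ⟨a, by simp [S]⟩
  have hSc : Sᶜ.Nonempty := ⟨b, by simpa [S] using hab⟩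
  have h_cut : ∀ u ∈ S, ∀ v ∉ S, G.Adj u v → s(u, v) ∈ F := by
    intro u hu v hv huv
    simp only [S, Finset.mem_filter, Finset.mem_univ, true_and] at hu hv
    by_contra h
    refine hv (hu.trans (SimpleGraph.Adj.reachable ?_))
    simpa [SimpleGraph.deleteEdges_adj] using ⟨huv, h⟩
  have h_le := l1Fiedler_le_of_cut_s15 G F S hS hSc h_cut
  have hs : (1 : ℝ) ≤ #S := by exact_mod_cast hS.card_pos
  have ht : (1 : ℝ) ≤ #Sᶜ := by exact_mod_cast hSc.card_pos
  have hst : (Fintype.card V : ℝ) = #S + #Sᶜ := by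
    exact_mod_cast (Finset.card_add_card_compl S).symm
  rw [hF_card] at h_le
  refine h_le.trans (div_le_div_of_nonneg_left (by positivity) ?_ ?_)
  · linarith
  · nlinarith [mul_nonneg (sub_nonneg.2 hs) (sub_nonneg.2 ht)]
end

section
/- Let G be a finite simple graph on n ≥ 2 vertices. Then b(G) ≤ iso(G). -/
open Finset

open Classical in
/-- The number of edges of `G` with exactly one endpoint in `S`, i.e. `|∂S|`
(each such edge is counted exactly once, as the ordered pair (u ∈ S, v ∉ S)). -/
noncomputable def cutCard {V : Type*} [Fintype V] (G : SimpleGraph V) (S : Finset V) : ℕ :=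
  ∑ u ∈ S, ∑ v ∈ Sᶜ, if G.Adj u v then 1 else 0
/-- The isoperimetric number `iso(G) = min { |∂S|/|S| : 0 < |S| ≤ ⌊n/2⌋ }`. -/
noncomputable def isoNumber {V : Type*} [Fintype V] (G : SimpleGraph V) : ℝ :=
  sInf { y : ℝ | ∃ S : Finset V, S.Nonempty ∧ 2 * S.card ≤ Fintype.card V ∧
    y = (cutCard G S : ℝ) / S.card }

open Classical in
/-- A function taking the value `a` on `S` and `b` off `S` has variation `|a - b| * |∂S|`. -/
theorem half_sum_adj_abs_sub_ite {V : Type*} [Fintype V] (G : SimpleGraph V) (S : Finset V)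
    (a b : ℝ) :
    (1 / 2) * ∑ u, ∑ v, (if G.Adj u v then
      |(if u ∈ S then a else b) - (if v ∈ S then a else b)| else 0) =
      |a - b| * (cutCard G S : ℝ) := by
  have hcut : (cutCard G S : ℝ) = ∑ u ∈ S, ∑ v ∈ Sᶜ, if G.Adj u v then (1 : ℝ) else 0 := by
    simp only [cutCard]
    push_cast
    rfl
  have hin : ∑ u ∈ S, ∑ v, (if G.Adj u v then
      |(if u ∈ S then a else b) - (if v ∈ S then a else b)| else 0) =
      |a - b| * (cutCard G S : ℝ) := by
    rw [hcut, mul_sum]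
    refine sum_congr rfl fun u hu => ?_
    rw [← sum_add_sum_compl S, mul_sum, sum_eq_zero (s := S), zero_add]
    · refine sum_congr rfl fun v hv => ?_
      simp [hu, mem_compl.mp hv]
    · intro v hv
      simp [hu, hv]
  have hout : ∑ u ∈ Sᶜ, ∑ v, (if G.Adj u v then
      |(if u ∈ S then a else b) - (if v ∈ S then a else b)| else 0) =
      |a - b| * (cutCard G S : ℝ) := by
    rw [hcut, sum_comm (s := S), mul_sum]
    refine sum_congr rfl fun u hu => ?_
    rw [← sum_add_sum_compl S, mul_sum, sum_eq_zero (s := Sᶜ), add_zero]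
    · refine sum_congr rfl fun v hv => ?_
      simp [hv, mem_compl.mp hu, G.adj_comm u v, abs_sub_comm b a]
    · intro v hv
      simp [mem_compl.mp hu, mem_compl.mp hv]
  rw [← sum_add_sum_compl S, hin, hout]
  ring

theorem sum_ite_mem_eq_card_mul {V : Type*} [Fintype V] [DecidableEq V] (S : Finset V)
    (a b : ℝ) :
    ∑ v, (if v ∈ S then a else b) = S.card * a + (Fintype.card V - S.card) * b := by
  have hcompl : ((Sᶜ.card : ℕ) : ℝ) = Fintype.card V - S.card := by
    rw [card_compl, Nat.cast_sub (card_le_univ S)]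
  rw [← sum_add_sum_compl S, sum_congr rfl fun v hv => if_pos hv,
    sum_congr rfl fun v hv => if_neg (mem_compl.mp hv)]
  simp [hcompl]

/-- Every admissible set bounds `b(G)` by its isoperimetric ratio. -/
theorem l1Fiedler_le_cutCard_div_card {V : Type*} [Fintype V] (G : SimpleGraph V)
    {S : Finset V} (hS : S.Nonempty) (hcard : 2 * S.card ≤ Fintype.card V) :
    l1Fiedler G ≤ (cutCard G S : ℝ) / S.card := by
  classical
  have hs : (0 : ℝ) < S.card := by exact_mod_cast hS.card_pos
  have hle : (S.card : ℝ) ≤ Fintype.card V - S.card := by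
    have : (2 : ℝ) * S.card ≤ Fintype.card V := by exact_mod_cast hcard
    linarith
  have ht : (0 : ℝ) < Fintype.card V - S.card := hs.trans_le hle
  have hinv := one_div_le_one_div_of_le hs hle
  have hsum := sum_ite_mem_eq_card_mul S
  have hvar := half_sum_adj_abs_sub_ite G S
  generalize (Fintype.card V : ℝ) - S.card = t at *
  have ha : (0 : ℝ) < 1 / S.card / 2 := by positivity
  have hb : (0 : ℝ) < 1 / t / 2 := by positivity
  calc l1Fiedler G ≤ |1 / S.card / 2 - -(1 / t / 2)| * (cutCard G S : ℝ) := by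
        refine csInf_le ⟨0, ?_⟩
          ⟨fun v => if v ∈ S then 1 / S.card / 2 else -(1 / t / 2), ?_, ?_, ?_⟩
        · rintro y ⟨x, -, -, rfl⟩
          refine mul_nonneg (by norm_num) (sum_nonneg fun u _ => sum_nonneg fun v _ => ?_)
          split_ifs <;> positivity
        · rw [hsum]
          field_simp
          ring
        · simp only [apply_ite abs, abs_neg, abs_of_pos ha, abs_of_pos hb]
          rw [hsum]
          field_simp
          norm_num
        · rw [← hvar]
    _ ≤ 1 / S.card * (cutCard G S : ℝ) := by
        gcongr
        rw [abs_of_pos (by linarith)]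
        linarith
    _ = (cutCard G S : ℝ) / S.card := by ring

/-- For a graph `G` on `n ≥ 2` vertices, `b(G) ≤ iso(G)`. -/
theorem stmt17 {V : Type*} [Fintype V] (G : SimpleGraph V) (hn : 2 ≤ Fintype.card V) :
    l1Fiedler G ≤ isoNumber G := by
  obtain ⟨v⟩ : Nonempty V := Fintype.card_pos_iff.mp (by omega)
  refine le_csInf ⟨_, {v}, singleton_nonempty v, by simpa using hn, rfl⟩ ?_
  rintro y ⟨S, hS, hcard, rfl⟩
  exact l1Fiedler_le_cutCard_div_card G hS hcard
end

section
/- Let G be a finite simple graph on n ≥ 2 vertices and let S be a subset of the vertex set V with |S| = ⌊n/2⌋ that induces a sparsest cut, i.e., |∂S|/(|S|·|V∖S|) ≤ |∂T|/(|T|·|V∖T|) for every nonempty proper subset T of V. Then S is an isoperimetric set, i.e., |∂S|/|S| = iso(G). -/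
open Finset

/-- Let `G` be a graph on `n ≥ 2` vertices and `S ⊆ V` with
`|S| = ⌊n/2⌋` inducing a sparsest cut (i.e. `|∂S|/(|S||Sᶜ|) ≤ |∂T|/(|T||Tᶜ|)` for every
nonempty proper `T ⊆ V`).  Then `S` is isoperimetric: `|∂S|/|S| = iso(G)`. -/
theorem stmt18 {V : Type*} [Fintype V] [DecidableEq V] (G : SimpleGraph V)
    (hn : 2 ≤ Fintype.card V)
    (S : Finset V) (hScard : S.card = Fintype.card V / 2)
    (hsparse : ∀ T : Finset V, T.Nonempty → T ≠ Finset.univ →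
      (cutCard G S : ℝ) / ((S.card : ℝ) * (Sᶜ.card : ℝ)) ≤
        (cutCard G T : ℝ) / ((T.card : ℝ) * (Tᶜ.card : ℝ))) :
    (cutCard G S : ℝ) / (S.card : ℝ) = isoNumber G := by
  have hSpos : 0 < S.card := by omega
  have hS : S.Nonempty := Finset.card_pos.mp hSpos
  have hdiv (T : Finset V) : (cutCard G T : ℝ) / ((T.card : ℝ) * (Tᶜ.card : ℝ)) =
      (cutCard G T : ℝ) / T.card / (Tᶜ.card : ℝ) := (div_div _ _ _).symm
  symm
  apply IsLeast.csInf_eq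
  refine ⟨⟨S, hS, by omega, rfl⟩, ?_⟩
  rintro _ ⟨T, hT, hTcard, rfl⟩
  have hTpos := hT.card_pos
  have hTuniv : T ≠ Finset.univ := by
    rintro rfl
    rw [Finset.card_univ] at hTcard
    omega
  have hSc := Finset.card_compl S
  have hTc := Finset.card_compl T
  have hSc0 : (0 : ℝ) < Sᶜ.card := by exact_mod_cast (by omega : 0 < Sᶜ.card)
  have hle : (Sᶜ.card : ℝ) ≤ Tᶜ.card := by exact_mod_cast (by omega : Sᶜ.card ≤ Tᶜ.card)
  have h := hsparse T hT hTuniv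
  rw [hdiv, hdiv] at h
  exact (div_le_div_iff_of_pos_right hSc0).mp
    (h.trans (div_le_div_of_nonneg_left (by positivity) hSc0 hle))
end

section
/- Let G be a connected r-regular finite simple graph on n ≥ 2 vertices. Then b(G) ≥ iso(G)/2. -/
open Finset

open Classical in
/-- The total variation `∑_{uv ∈ E(G)} |x_u - x_v|` of a function on the vertices. -/
noncomputable def totalVariation {V : Type*} [Fintype V] (G : SimpleGraph V) (x : V → ℝ) : ℝ :=
  (1 / 2) * ∑ u, ∑ v, if G.Adj u v then |x u - x v| else 0

section

variable {V : Type*} [Fintype V] (G : SimpleGraph V)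

theorem totalVariation_nonneg (x : V → ℝ) : 0 ≤ totalVariation G x := by
  unfold totalVariation
  refine mul_nonneg (by norm_num) (sum_nonneg fun u _ => sum_nonneg fun v _ => ?_)
  split_ifs <;> positivity

theorem totalVariation_add_mul {x y z : V → ℝ} {c : ℝ}
    (h : ∀ u v, |x u - x v| = |y u - y v| + c * |z u - z v|) :
    totalVariation G x = totalVariation G y + c * totalVariation G z := by
  unfold totalVariation
  rw [mul_left_comm, ← mul_add, mul_sum _ _ c, ← sum_add_distrib]
  congr 1
  refine sum_congr rfl fun u _ => ?_
  rw [mul_sum, ← sum_add_distrib]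
  refine sum_congr rfl fun v _ => ?_
  split_ifs
  · exact h u v
  · simp

open Classical in
theorem totalVariation_indicator (S : Finset V) :
    totalVariation G (fun v => if v ∈ S then 1 else 0) = cutCard G S := by
  have hcut : (cutCard G S : ℝ) =
      ∑ u, ∑ v, if u ∈ S ∧ v ∉ S ∧ G.Adj u v then (1 : ℝ) else 0 := by
    unfold cutCard
    push_cast
    rw [← sum_filter_add_sum_filter_not univ (· ∈ S)
      (fun u => ∑ v, if u ∈ S ∧ v ∉ S ∧ G.Adj u v then (1 : ℝ) else 0)]
    rw [sum_eq_zero (s := univ.filter fun u => u ∉ S), add_zero]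
    · rw [filter_mem_eq_inter, univ_inter]
      refine sum_congr rfl fun u hu => ?_
      rw [← sum_subset (subset_univ Sᶜ)]
      · refine sum_congr rfl fun v hv => ?_
        simp [hu, mem_compl.1 hv]
      · intro v _ hv
        simp_all
    · intro u hu
      simp_all
  have hsum : (∑ u, ∑ v, if G.Adj u v then
      |(if u ∈ S then (1 : ℝ) else 0) - (if v ∈ S then 1 else 0)| else 0) =
      (∑ u, ∑ v, if u ∈ S ∧ v ∉ S ∧ G.Adj u v then (1 : ℝ) else 0) +
      ∑ u, ∑ v, if v ∈ S ∧ u ∉ S ∧ G.Adj v u then (1 : ℝ) else 0 := by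
    simp only [← sum_add_distrib]
    refine sum_congr rfl fun u _ => sum_congr rfl fun v _ => ?_
    by_cases hu : u ∈ S <;> by_cases hv : v ∈ S <;> simp [hu, hv, G.adj_comm]
  unfold totalVariation
  rw [hsum, sum_comm (f := fun u v => if v ∈ S ∧ u ∉ S ∧ G.Adj v u then (1 : ℝ) else 0), hcut]
  ring

theorem isoNumber_mul_card_le_cutCard {S : Finset V} (hS : 2 * S.card ≤ Fintype.card V) :
    isoNumber G * S.card ≤ cutCard G S := by
  rcases S.eq_empty_or_nonempty with rfl | hne
  · simp
  · rw [← le_div_iff₀ (by exact_mod_cast hne.card_pos)]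
    refine csInf_le ⟨0, ?_⟩ ⟨S, hne, hS, rfl⟩
    rintro _ ⟨T, -, -, rfl⟩
    positivity

/-- The discrete coarea inequality for a nonnegative function supported on at most half
of the vertices. -/
theorem isoNumber_mul_sum_le_totalVariation (f : V → ℝ) (hf : ∀ v, 0 ≤ f v)
    (hcard : 2 * (univ.filter fun v => 0 < f v).card ≤ Fintype.card V) :
    isoNumber G * ∑ v, f v ≤ totalVariation G f := by
  classical
  induction hk : (univ.filter fun v => 0 < f v).card using Nat.strong_induction_on
    generalizing f with
  | _ k ih =>
  set S := univ.filter fun v => 0 < f v with hSdef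
  rcases S.eq_empty_or_nonempty with hS | hS
  · have h0 : ∀ v, f v = 0 := fun v => by
      have : v ∉ S := by simp [hS]
      exact le_antisymm (by simpa [hSdef] using this) (hf v)
    simpa [h0] using totalVariation_nonneg G f
  · obtain ⟨w, hwS, hw⟩ := S.exists_min_image f hS
    have hwpos : 0 < f w := by simpa [hSdef] using hwS
    have hout : ∀ v, v ∉ S → f v = 0 := fun v hv =>
      le_antisymm (by simpa [hSdef] using hv) (hf v)
    set g : V → ℝ := fun v => f v - f w * (if v ∈ S then 1 else 0) with hg
    have hg0 : ∀ v, 0 ≤ g v := fun v => by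
      by_cases hv : v ∈ S
      · simpa [hg, hv] using hw v hv
      · simp [hg, hv, hout v hv]
    have hsub : (univ.filter fun v => 0 < g v) ⊂ S := by
      refine (ssubset_iff_of_subset fun v hv => ?_).2 ⟨w, hwS, by simp [hg, hwS]⟩
      by_contra hvS
      simp [hg, hvS, hout v hvS] at hv
    have hlt := card_lt_card hsub
    have hrec := ih _ (hk ▸ hlt) g hg0 (by omega) rfl
    have htv : totalVariation G f =
        totalVariation G g + f w * totalVariation G (fun v => if v ∈ S then 1 else 0) := by
      refine totalVariation_add_mul G fun u v => ?_
      by_cases hu : u ∈ S <;> by_cases hv : v ∈ S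
      · simp [hg, hu, hv]
      · have := hw u hu
        simp only [hg, hu, hv, hout v hv, if_true, if_false]
        rw [abs_of_nonneg (by linarith), abs_of_nonneg (by linarith)]
        simp
      · have := hw v hv
        simp only [hg, hu, hv, hout u hu, if_true, if_false]
        rw [abs_of_nonpos (by linarith), abs_of_nonpos (by linarith)]
        simp
      · simp [hg, hu, hv]
    have hsum : ∑ v, f v = ∑ v, g v + f w * S.card := by
      simp only [hg, sum_sub_distrib, ← mul_sum]
      simp
    have hcut := mul_le_mul_of_nonneg_left (isoNumber_mul_card_le_cutCard G hcard) hwpos.le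
    rw [htv, totalVariation_indicator, hsum]
    linarith

theorem exists_median [Nonempty V] (x : V → ℝ) :
    ∃ m, 2 * (univ.filter fun v => m < x v).card ≤ Fintype.card V ∧
      2 * (univ.filter fun v => x v < m).card ≤ Fintype.card V := by
  classical
  obtain ⟨t, -, ht⟩ := (univ : Finset V).exists_max_image x univ_nonempty
  obtain ⟨w, hw, hmin⟩ := (univ.filter fun w =>
    2 * (univ.filter fun v => x w < x v).card ≤ Fintype.card V).exists_min_image x
      ⟨t, by simp [filter_false_of_mem (s := univ) fun v hv => not_lt.2 (ht v hv)]⟩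
  refine ⟨x w, (mem_filter.1 hw).2, ?_⟩
  rcases (univ.filter fun v => x v < x w).eq_empty_or_nonempty with h | h
  · simp [h]
  · obtain ⟨z, hz, hzmax⟩ := exists_max_image _ x h
    have hzw : x z < x w := (mem_filter.1 hz).2
    have hzcard : Fintype.card V < 2 * (univ.filter fun v => x z < x v).card := by
      by_contra hcon
      exact absurd (hmin z (mem_filter.2 ⟨mem_univ _, not_lt.1 hcon⟩)) (not_le.2 hzw)
    have hdisj : Disjoint (univ.filter fun v => x v < x w) (univ.filter fun v => x z < x v) := by
      refine disjoint_left.2 fun v hv hv' => ?_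
      exact absurd (mem_filter.1 hv').2 (not_lt.2 (hzmax v hv))
    have := card_le_univ ((univ.filter fun v => x v < x w) ∪ (univ.filter fun v => x z < x v))
    rw [card_union_of_disjoint hdisj] at this
    omega

theorem isoNumber_mul_sum_abs_sub_le_totalVariation (x : V → ℝ) {m : ℝ}
    (hpos : 2 * (univ.filter fun v => m < x v).card ≤ Fintype.card V)
    (hneg : 2 * (univ.filter fun v => x v < m).card ≤ Fintype.card V) :
    isoNumber G * ∑ v, |x v - m| ≤ totalVariation G x := by
  have h1 := isoNumber_mul_sum_le_totalVariation G (fun v => max (x v - m) 0)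
    (fun v => le_max_right _ _) (by simpa using hpos)
  have h2 := isoNumber_mul_sum_le_totalVariation G (fun v => max (m - x v) 0)
    (fun v => le_max_right _ _) (by simpa using hneg)
  have htv : totalVariation G x = totalVariation G (fun v => max (x v - m) 0) +
      1 * totalVariation G (fun v => max (m - x v) 0) := by
    refine totalVariation_add_mul G fun u v => ?_
    rcases le_total (x u) m with hu | hu <;> rcases le_total (x v) m with hv | hv <;>
      simp only [max_def] <;> split_ifs <;> grind
  have hsum : ∑ v, |x v - m| = ∑ v, max (x v - m) 0 + ∑ v, max (m - x v) 0 := by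
    rw [← sum_add_distrib]
    refine sum_congr rfl fun v _ => ?_
    grind
  rw [htv, hsum]
  linarith

theorem sum_abs_le_two_mul_sum_abs_sub {x : V → ℝ} (hx : ∑ v, x v = 0) (m : ℝ) :
    ∑ v, |x v| ≤ 2 * ∑ v, |x v - m| := by
  have h1 : ∑ v, |x v| ≤ ∑ v, (|x v - m| + |m|) :=
    sum_le_sum fun v _ => by simpa using abs_add_le (x v - m) m
  have h2 : |∑ v, (x v - m)| ≤ ∑ v, |x v - m| := abs_sum_le_sum_abs _ _
  simp only [sum_sub_distrib, sum_add_distrib, hx, sum_const, nsmul_eq_mul, zero_sub, abs_neg,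
    abs_mul, Nat.abs_cast] at h1 h2
  linarith

theorem isoNumber_nonneg : 0 ≤ isoNumber G := by
  refine Real.sInf_nonneg ?_
  rintro _ ⟨T, -, -, rfl⟩
  positivity

end

/-- Let `G` be a connected `r`-regular graph on `n ≥ 2` vertices.
Then `b(G) ≥ iso(G)/2`. -/
theorem stmt19 {V : Type*} [Fintype V] (G : SimpleGraph V) [DecidableRel G.Adj]
    (hG : G.Connected) (hn : 2 ≤ Fintype.card V)
    (r : ℕ) (hreg : G.IsRegularOfDegree r) :
    l1Fiedler G ≥ isoNumber G / 2 := by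
  classical
  obtain ⟨a, b, hab⟩ := Fintype.exists_pair_of_one_lt_card hn
  have : Nonempty V := ⟨a⟩
  refine le_csInf ⟨_, fun v => if v = a then 1 / 2 else if v = b then -1 / 2 else 0, ?_, ?_, rfl⟩ ?_
  · rw [Fintype.sum_eq_add a b hab (by grind)]
    simp only [if_true, if_neg hab.symm]
    norm_num
  · rw [Fintype.sum_eq_add a b hab (by grind)]
    simp only [if_true, if_neg hab.symm]
    norm_num [abs_of_pos, abs_of_neg]
  · rintro y ⟨x, hx0, hx1, rfl⟩
    obtain ⟨m, hpos, hneg⟩ := exists_median x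
    have hiso := isoNumber_mul_sum_abs_sub_le_totalVariation G x hpos hneg
    have hsum := sum_abs_le_two_mul_sum_abs_sub hx0 m
    rw [hx1] at hsum
    have := mul_le_mul_of_nonneg_left hsum (isoNumber_nonneg G)
    unfold totalVariation at hiso
    linarith
end
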